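/- arXiv:math/0310382 — 2 statements merged into one kernel-verified Lean document; each statement's English description precedes it below -/
import Mathlib

section
/- Let a ≥ 0 be an integer and τ > 1/2 a real number. Then there is a constant K depending only on a and τ such that for all U ≥ 1, ∫_1^U |ζ^{(a)}(τ + it)|⁴ dt ≤ K·U, where ζ^{(a)} denotes the a-th derivative of the Riemann zeta function. -/
open Complex

lemma sq_intervalIntegral_mul_le {a b : ℝ} (hab : a ≤ b) {u v : ℝ → ℝ} (hu : Continuous u)
    (hv : Continuous v) :
    (∫ t in a..b, u t * v t) ^ 2 ≤ (∫ t in a..b, u t ^ 2) * ∫ t in a..b, v t ^ 2 := by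
  have key : ∀ x : ℝ, 0 ≤ (∫ t in a..b, v t ^ 2) * (x * x) + (-2 * ∫ t in a..b, u t * v t) * x +
      ∫ t in a..b, u t ^ 2 := by
    intro x
    have h : 0 ≤ ∫ t in a..b, (u t - x * v t) ^ 2 :=
      intervalIntegral.integral_nonneg hab fun t _ ↦ sq_nonneg _
    have e : ∀ t, (u t - x * v t) ^ 2 = (x * x) * v t ^ 2 + (-2 * x) * (u t * v t) + u t ^ 2 :=
      fun t ↦ by ring
    simp_rw [e] at h
    rw [intervalIntegral.integral_add (by apply Continuous.intervalIntegrable; fun_prop)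
      (by apply Continuous.intervalIntegrable; fun_prop),
      intervalIntegral.integral_add (by apply Continuous.intervalIntegrable; fun_prop)
      (by apply Continuous.intervalIntegrable; fun_prop), intervalIntegral.integral_const_mul,
      intervalIntegral.integral_const_mul] at h
    linarith
  have := discrim_le_zero key
  rw [discrim] at this
  linarith

lemma norm_intervalIntegral_mul_sq_le {a b : ℝ} (hab : a ≤ b) {f g : ℝ → ℂ} (hf : Continuous f)
    (hg : Continuous g) :
    ‖∫ t in a..b, f t * g t‖ ^ 2 ≤ (∫ t in a..b, ‖f t‖ ^ 2) * ∫ t in a..b, ‖g t‖ ^ 2 := by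
  refine le_trans ?_ (sq_intervalIntegral_mul_le hab hf.norm hg.norm)
  gcongr
  refine (intervalIntegral.norm_integral_le_integral_norm hab).trans (le_of_eq ?_)
  simp_rw [norm_mul]

lemma differentiableAt_intervalIntegral_translate {f : ℂ → ℂ}
    (hf : DifferentiableOn ℂ f {z | 0 < z.re}) {φ : ℝ → ℂ} (hφ : Continuous φ) (a b : ℝ)
    {z₀ : ℂ} (hz₀ : 0 < z₀.re) :
    DifferentiableAt ℂ (fun z ↦ ∫ t in a..b, f (z + t * I) * φ t) z₀ := by
  have ho : IsOpen {z : ℂ | 0 < z.re} := isOpen_lt continuous_const continuous_re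
  have hre : ∀ z ∈ Metric.closedBall z₀ (z₀.re / 2), 0 < z.re := by
    intro z hz
    have h1 := (abs_re_le_norm (z - z₀)).trans (mem_closedBall_iff_norm.mp hz)
    rw [sub_re, abs_le] at h1
    linarith
  have hcont : ∀ {g : ℂ → ℂ}, ContinuousOn g {z | 0 < z.re} → ∀ z : ℂ, 0 < z.re →
      Continuous fun t : ℝ ↦ g (z + t * I) := by
    intro g hg z hz
    exact hg.comp_continuous (by fun_prop) (by simp [hz])
  have hderiv : ContinuousOn (deriv f) {z | 0 < z.re} := (hf.deriv ho).continuousOn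
  obtain ⟨C, hC⟩ : ∃ C, ∀ p ∈ Metric.closedBall z₀ (z₀.re / 2) ×ˢ Set.uIcc a b,
      ‖deriv f (p.1 + (p.2 : ℝ) * I) * φ p.2‖ ≤ C := by
    refine ((isCompact_closedBall _ _).prod isCompact_uIcc).exists_bound_of_continuousOn
      (ContinuousOn.mul (hderiv.comp (by fun_prop) ?_) (by fun_prop))
    rintro ⟨z, t⟩ ⟨hz, -⟩
    simpa using hre z hz
  refine (intervalIntegral.hasDerivAt_integral_of_dominated_loc_of_deriv_le
    (F := fun z t ↦ f (z + t * I) * φ t) (F' := fun z t ↦ deriv f (z + t * I) * φ t)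
    (s := Metric.closedBall z₀ (z₀.re / 2)) (bound := fun _ ↦ C)
    (Metric.closedBall_mem_nhds _ (by linarith)) ?_ ?_ ?_ ?_ (by simp) ?_).2.differentiableAt
  · filter_upwards [ho.mem_nhds hz₀] with z hz
    exact ((hcont hf.continuousOn z hz).mul hφ).aestronglyMeasurable
  · exact ((hcont hf.continuousOn z₀ hz₀).mul hφ).intervalIntegrable _ _
  · exact ((hcont hderiv z₀ hz₀).mul hφ).aestronglyMeasurable
  · exact .of_forall fun t ht z hz ↦ hC (z, t) ⟨hz, Set.uIoc_subset_uIcc ht⟩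
  · refine .of_forall fun t ht z hz ↦ ?_
    have h1 : HasDerivAt f (deriv f (z + t * I)) (z + t * I) :=
      (hf.differentiableAt (ho.mem_nhds (by simpa using hre z hz))).hasDerivAt
    exact (h1.comp_add_const z (t * I)).mul_const (φ t)

/-- Three lines theorem for square means: the mean square of a bounded holomorphic function on
vertical lines is logarithmically convex in the abscissa. -/
theorem meanSquare_le_interp {f : ℂ → ℂ} {l u A B σ : ℝ} (hl : 0 < l) (hlu : l < u)
    (hσ : σ ∈ Set.Icc l u) (hf : DifferentiableOn ℂ f {z | 0 < z.re})
    (hb : ∃ C, ∀ z : ℂ, z.re ∈ Set.Icc l u → ‖f z‖ ≤ C)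
    (hA : ∀ R, 0 ≤ R → ∫ t in (-R)..R, ‖f (l + t * I)‖ ^ 2 ≤ A)
    (hB : ∀ R, 0 ≤ R → ∫ t in (-R)..R, ‖f (u + t * I)‖ ^ 2 ≤ B) {R : ℝ} (hR : 0 ≤ R) :
    ∫ t in (-R)..R, ‖f (σ + t * I)‖ ^ 2 ≤
      A ^ (1 - (σ - l) / (u - l)) * B ^ ((σ - l) / (u - l)) := by
  have hline : ∀ z : ℂ, 0 < z.re → Continuous fun t : ℝ ↦ f (z + t * I) := fun z hz ↦
    hf.continuousOn.comp_continuous (by fun_prop) (by simp [hz])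
  have hσ0 : 0 < σ := hl.trans_le hσ.1
  have hA0 : 0 ≤ A := by simpa using hA 0 le_rfl
  have hB0 : 0 ≤ B := by simpa using hB 0 le_rfl
  set N := ∫ t in (-R)..R, ‖f (σ + t * I)‖ ^ 2 with hN
  have hN0 : 0 ≤ N := intervalIntegral.integral_nonneg (by linarith) fun _ _ ↦ by positivity
  set φ : ℝ → ℂ := fun t ↦ (starRingEnd ℂ) (f (σ + t * I)) with hφ
  have hφc : Continuous φ := continuous_conj.comp (hline σ (by simpa using hσ0))
  have hφn : ∫ t in (-R)..R, ‖φ t‖ ^ 2 = N := by simp [hφ, hN]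
  set Φ : ℂ → ℂ := fun z ↦ ∫ t in (-R)..R, f (z + t * I) * φ t with hΦ
  have hΦσ : ‖Φ σ‖ = N := by
    have : Φ σ = ((N : ℝ) : ℂ) := by
      rw [hN, ← intervalIntegral.integral_ofReal]
      refine intervalIntegral.integral_congr fun t _ ↦ ?_
      simp [hφ, mul_conj, normSq_eq_norm_sq]
    rw [this, norm_real, Real.norm_of_nonneg hN0]
  have hCS : ∀ z : ℂ, 0 < z.re → ‖Φ z‖ ^ 2 ≤ (∫ t in (-R)..R, ‖f (z + t * I)‖ ^ 2) * N :=
    fun z hz ↦ (norm_intervalIntegral_mul_sq_le (by linarith) (hline z hz) hφc).trans_eq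
      (by rw [hφn])
  have hedge : ∀ {c M : ℝ}, 0 < c → (∀ R, 0 ≤ R → ∫ t in (-R)..R, ‖f (c + t * I)‖ ^ 2 ≤ M) →
      ∀ z ∈ re ⁻¹' {c}, ‖Φ z‖ ≤ √(M * N) := by
    intro c M hc hM z hz
    have hz' : z.re = c := hz
    refine Real.le_sqrt_of_sq_le ((hCS z (by simpa [hz'] using hc)).trans ?_)
    gcongr
    have e : ∀ t : ℝ, z + t * I = c + ((t + z.im : ℝ) : ℂ) * I := fun t ↦ by
      apply Complex.ext <;> simp [hz', add_comm]
    simp_rw [e]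
    rw [intervalIntegral.integral_comp_add_right (fun t ↦ ‖f (c + (t : ℝ) * I)‖ ^ 2)]
    refine le_trans ?_ (hM (R + |z.im|) (by positivity))
    refine intervalIntegral.integral_mono_interval ?_ (by linarith) ?_
      (.of_forall fun t ↦ by positivity) ?_
    · linarith [neg_abs_le z.im]
    · linarith [le_abs_self z.im]
    · exact (((hline c (by simpa using hc)).norm).pow 2).intervalIntegrable _ _
  have hdiff : DifferentiableOn ℂ Φ {z | 0 < z.re} := fun z hz ↦
    (differentiableAt_intervalIntegral_translate hf hφc _ _ hz).differentiableWithinAt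
  have hdcl : DiffContOnCl ℂ Φ (HadamardThreeLines.verticalStrip l u) := by
    apply DifferentiableOn.diffContOnCl
    refine hdiff.mono fun z hz ↦ ?_
    have : closure (HadamardThreeLines.verticalStrip l u) ⊆ {z : ℂ | l ≤ z.re} :=
      closure_minimal (fun w hw ↦ hw.1.le) (isClosed_le continuous_const continuous_re)
    exact hl.trans_le (this hz)
  have hbdd : BddAbove ((norm ∘ Φ) '' HadamardThreeLines.verticalClosedStrip l u) := by
    obtain ⟨C, hC⟩ := hb
    refine ⟨√((2 * R * C ^ 2) * N), ?_⟩
    rintro _ ⟨z, hz, rfl⟩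
    have hz' : z.re ∈ Set.Icc l u := hz
    refine Real.le_sqrt_of_sq_le ((hCS z (hl.trans_le hz'.1)).trans ?_)
    gcongr
    calc ∫ t in (-R)..R, ‖f (z + t * I)‖ ^ 2 ≤ ∫ t in (-R)..R, C ^ 2 := by
          refine intervalIntegral.integral_mono_on (by linarith) ?_ (by simp) fun t _ ↦ ?_
          · exact (((hline z (hl.trans_le hz'.1)).norm).pow 2).intervalIntegrable _ _
          · gcongr
            exact hC _ (by simpa using hz')
      _ = 2 * R * C ^ 2 := by rw [intervalIntegral.integral_const, smul_eq_mul]; ring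
  have h3 := HadamardThreeLines.norm_le_interp_of_mem_verticalClosedStrip' hlu (z := (σ : ℂ))
    (by simpa [HadamardThreeLines.verticalClosedStrip] using hσ) hdcl hbdd (hedge hl hA)
    (hedge (hl.trans hlu) hB)
  rw [hΦσ, ofReal_re] at h3
  set θ := (σ - l) / (u - l) with hθ
  rcases hN0.eq_or_lt with h | h
  · rw [← h]; positivity
  rw [Real.sqrt_mul hA0, Real.sqrt_mul hB0, Real.mul_rpow (by positivity) (by positivity),
    Real.mul_rpow (by positivity) (by positivity)] at h3
  have e1 : √N ^ (1 - θ) * √N ^ θ = √N := by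
    rw [← Real.rpow_add (by positivity)]; simp
  have h4 : √N ≤ √A ^ (1 - θ) * √B ^ θ := by
    have hs : 0 < √N := by positivity
    refine le_of_mul_le_mul_right ?_ hs
    calc √N * √N = N := Real.mul_self_sqrt hN0
      _ ≤ _ := h3
      _ = √A ^ (1 - θ) * √B ^ θ * (√N ^ (1 - θ) * √N ^ θ) := by ring
      _ = _ := by rw [e1]
  calc N = √N ^ 2 := (Real.sq_sqrt hN0).symm
    _ ≤ (√A ^ (1 - θ) * √B ^ θ) ^ 2 := by gcongr
    _ = (√A ^ 2) ^ (1 - θ) * (√B ^ 2) ^ θ := by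
      rw [mul_pow, ← Real.rpow_natCast, ← Real.rpow_natCast, ← Real.rpow_mul (by positivity),
        ← Real.rpow_mul (by positivity), ← Real.rpow_natCast, ← Real.rpow_natCast,
        ← Real.rpow_mul (by positivity), ← Real.rpow_mul (by positivity)]
      ring_nf
    _ = _ := by rw [Real.sq_sqrt hA0, Real.sq_sqrt hB0]

lemma norm_cos_le_cosh_im (z : ℂ) : ‖cos z‖ ≤ Real.cosh z.im := by
  rw [← abs_of_pos (Real.cosh_pos z.im), ← sq_le_sq₀ (norm_nonneg _) (abs_nonneg _), sq_abs]
  have h : cos z = ((Real.cos z.re * Real.cosh z.im : ℝ) : ℂ) +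
      ((-(Real.sin z.re * Real.sinh z.im) : ℝ) : ℂ) * I := by
    conv_lhs => rw [← re_add_im z, cos_add_mul_I]
    push_cast
    ring
  rw [h, ← normSq_eq_norm_sq, normSq_add_mul_I]
  nlinarith [Real.cosh_sq z.im, Real.sin_sq_add_cos_sq z.re, sq_nonneg (Real.cos z.re),
    sq_nonneg (Real.sin z.re)]

lemma Real.cosh_le_exp_abs (x : ℝ) : Real.cosh x ≤ Real.exp |x| := by
  rw [Real.cosh_eq]
  have h1 := Real.exp_le_exp.mpr (le_abs_self x)
  have h2 := Real.exp_le_exp.mpr (neg_le_abs x)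
  linarith

lemma norm_Gamma_one_half_add_sq (t : ℝ) :
    ‖Gamma (1 / 2 + t * I)‖ ^ 2 = Real.pi / Real.cosh (Real.pi * t) := by
  have h := Complex.Gamma_mul_Gamma_one_sub (1 / 2 + t * I)
  have e : (1 : ℂ) - (1 / 2 + t * I) = (starRingEnd ℂ) (1 / 2 + t * I) := by
    apply Complex.ext <;> norm_num
  have e2 : sin (Real.pi * (1 / 2 + t * I)) = ((Real.cosh (Real.pi * t) : ℝ) : ℂ) := by
    rw [show (Real.pi : ℂ) * (1 / 2 + t * I) = (Real.pi * t : ℂ) * I + Real.pi / 2 by ring,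
      Complex.sin_add_pi_div_two, Complex.cos_mul_I]
    push_cast
    rfl
  rw [e, Gamma_conj, mul_conj, normSq_eq_norm_sq, e2] at h
  exact_mod_cast h

lemma norm_Gamma_mul_cos_one_half_le (t : ℝ) {y : ℝ} (hy : |y| = |Real.pi * t / 2|) :
    ‖Gamma (1 / 2 + t * I)‖ * Real.cosh y ≤ 2 := by
  have h1 := norm_Gamma_one_half_add_sq t
  have h2 := Real.cosh_pos (Real.pi * t)
  have h3 : Real.cosh y ^ 2 ≤ Real.cosh (Real.pi * t) := by
    rw [← Real.cosh_abs y, hy, Real.cosh_abs,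
      show Real.pi * t = 2 * (Real.pi * t / 2) by ring, Real.cosh_two_mul,
      show 2 * (Real.pi * t / 2) / 2 = Real.pi * t / 2 by ring]
    nlinarith [Real.cosh_sq (Real.pi * t / 2)]
  refine abs_le_of_sq_le_sq' ?_ (by norm_num) |>.2
  rw [mul_pow, h1, div_mul_eq_mul_div, div_le_iff₀ h2]
  nlinarith [Real.pi_le_four, Real.pi_pos]

lemma norm_Gamma_le_of_re_pos {z : ℂ} (hz : 0 < z.re) : ‖Gamma z‖ ≤ Real.Gamma z.re := by
  rw [Gamma_eq_integral hz, Real.Gamma_eq_integral hz, GammaIntegral]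
  refine (MeasureTheory.norm_integral_le_integral_norm _).trans (le_of_eq ?_)
  refine MeasureTheory.setIntegral_congr_fun measurableSet_Ioi fun x hx ↦ ?_
  have hx' : 0 < x := hx
  simp [norm_cpow_eq_rpow_re_of_pos hx', Complex.norm_exp]

lemma norm_exp_sq (z : ℂ) : ‖exp (z ^ 2)‖ = Real.exp (z.re ^ 2 - z.im ^ 2) := by
  rw [Complex.norm_exp]
  simp [pow_two]

lemma norm_Gamma_mul_cos_le {σ : ℝ} (hσ : σ ∈ Set.Icc (1 / 2 : ℝ) (3 / 2)) (t : ℝ) :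
    ‖Gamma (σ + t * I) * cos (Real.pi * (σ + t * I) / 2)‖ ≤
      4 * Real.exp 3 * (1 + |t|) ^ (σ - 1 / 2) := by
  set G : ℂ → ℂ := fun z ↦ Gamma z * cos (Real.pi * z / 2) * exp ((z - t * I) ^ 2) with hG
  have hdiff : DifferentiableOn ℂ G {z | 0 < z.re} := by
    intro z hz
    have : DifferentiableAt ℂ Gamma z := differentiableAt_Gamma z fun m hm ↦ by
      have := congrArg re hm
      simp only [neg_re, natCast_re] at this
      have h0 : 0 < z.re := hz
      have := m.cast_nonneg (α := ℝ)
      linarith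
    exact (by fun_prop : DifferentiableAt ℂ G z).differentiableWithinAt
  have hcos : ∀ z : ℂ, ‖cos (Real.pi * z / 2)‖ ≤ Real.cosh (Real.pi * z.im / 2) := fun z ↦ by
    have := norm_cos_le_cosh_im (Real.pi * z / 2)
    rwa [show ((Real.pi : ℂ) * z / 2).im = Real.pi * z.im / 2 by simp] at this
  have hexp : ∀ z : ℂ, ‖exp ((z - t * I) ^ 2)‖ = Real.exp (z.re ^ 2 - (z.im - t) ^ 2) :=
    fun z ↦ by rw [norm_exp_sq]; simp
  have hdcl : DiffContOnCl ℂ G (HadamardThreeLines.verticalStrip (1 / 2) (3 / 2)) := by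
    apply DifferentiableOn.diffContOnCl
    refine hdiff.mono fun z hz ↦ ?_
    have : closure (HadamardThreeLines.verticalStrip (1 / 2) (3 / 2)) ⊆ {z : ℂ | 1 / 2 ≤ z.re} :=
      closure_minimal (fun w hw ↦ hw.1.le) (isClosed_le continuous_const continuous_re)
    exact one_half_pos.trans_le (show (1 / 2 : ℝ) ≤ z.re from this hz)
  have hbdd : BddAbove ((norm ∘ G) ''
      HadamardThreeLines.verticalClosedStrip (1 / 2) (3 / 2)) := by
    obtain ⟨C, hC⟩ := isCompact_Icc.exists_bound_of_continuousOn
      ((Real.differentiableOn_Gamma_Ioi.continuousOn).mono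
        (fun x hx ↦ one_half_pos.trans_le hx.1) : ContinuousOn Real.Gamma
          (Set.Icc (1 / 2 : ℝ) (3 / 2)))
    refine ⟨C * Real.exp (2 * |t| + 4), ?_⟩
    rintro _ ⟨z, hz, rfl⟩
    have hz' : z.re ∈ Set.Icc (1 / 2 : ℝ) (3 / 2) := hz
    have h1 : ‖Gamma z‖ ≤ C := (norm_Gamma_le_of_re_pos (one_half_pos.trans_le hz'.1)).trans
      ((le_abs_self _).trans (hC _ hz'))
    have hC0 : 0 ≤ C := (norm_nonneg _).trans h1
    simp only [Function.comp, hG, norm_mul, mul_assoc]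
    refine mul_le_mul h1 ?_ (by positivity) hC0
    rw [hexp]
    calc _ ≤ Real.exp |Real.pi * z.im / 2| * Real.exp (z.re ^ 2 - (z.im - t) ^ 2) := by
          gcongr
          exact (hcos z).trans (Real.cosh_le_exp_abs _)
      _ ≤ _ := by
          rw [← Real.exp_add, Real.exp_le_exp]
          have e1 : |Real.pi * z.im / 2| ≤ 2 * |z.im| := by
            rw [abs_div, abs_mul, abs_of_pos Real.pi_pos, abs_two]
            nlinarith [Real.pi_le_four, abs_nonneg z.im]
          have e2 : |z.im| ≤ |z.im - t| + |t| := by simpa using abs_add_le (z.im - t) t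
          nlinarith [sq_abs (z.im - t), sq_nonneg (|z.im - t| - 1), hz'.1, hz'.2]
  have hl : ∀ z ∈ re ⁻¹' {(1 / 2 : ℝ)}, ‖G z‖ ≤ 4 * Real.exp (9 / 4) := by
    intro z hz
    have hz' : z.re = 1 / 2 := hz
    have ez : z = 1 / 2 + z.im * I := by apply Complex.ext <;> simp [hz']
    have h1 : ‖Gamma z‖ * Real.cosh (Real.pi * z.im / 2) ≤ 2 := by
      have := norm_Gamma_mul_cos_one_half_le z.im (y := Real.pi * z.im / 2) rfl
      rwa [← ez] at this
    simp only [hG, norm_mul, hexp]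
    have h2 : ‖Gamma z‖ * ‖cos (Real.pi * z / 2)‖ ≤ 4 :=
      (mul_le_mul_of_nonneg_left (hcos z) (norm_nonneg _)).trans (h1.trans (by norm_num))
    refine mul_le_mul h2 ?_ (by positivity) (by norm_num)
    rw [Real.exp_le_exp, hz']
    nlinarith [sq_nonneg (z.im - t)]
  have hr : ∀ z ∈ re ⁻¹' {(3 / 2 : ℝ)}, ‖G z‖ ≤ 4 * Real.exp (9 / 4) * (1 + |t|) := by
    intro z hz
    have hz' : z.re = 3 / 2 := hz
    have ez : z = (1 / 2 + z.im * I) + 1 := by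
      apply Complex.ext
      · simp [hz']; norm_num
      · simp
    have hne : (1 / 2 + z.im * I : ℂ) ≠ 0 := fun h ↦ by
      have := congrArg re h
      simp at this
    have hn : ‖(1 / 2 + z.im * I : ℂ)‖ ≤ 1 + |z.im| := by
      refine (norm_add_le _ _).trans ?_
      simp
      norm_num
    have h1 : ‖Gamma z‖ * Real.cosh (Real.pi * z.im / 2) ≤ (1 + |z.im|) * 2 := by
      have := norm_Gamma_mul_cos_one_half_le z.im (y := Real.pi * z.im / 2) rfl
      rw [ez, Gamma_add_one _ hne, norm_mul, ← ez, mul_assoc]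
      exact mul_le_mul hn this (mul_nonneg (norm_nonneg _) (Real.cosh_pos _).le) (by positivity)
    simp only [hG, norm_mul, hexp]
    have h2 : ‖Gamma z‖ * ‖cos (Real.pi * z / 2)‖ ≤ (1 + |z.im|) * 2 :=
      (mul_le_mul_of_nonneg_left (hcos z) (norm_nonneg _)).trans h1
    have h3 : (1 + |z.im|) ≤ (1 + |t|) * (2 * Real.exp ((z.im - t) ^ 2)) := by
      have e2 : |z.im| ≤ |z.im - t| + |t| := by simpa using abs_add_le (z.im - t) t
      have e3 := Real.add_one_le_exp ((z.im - t) ^ 2)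
      have e4 : 1 + |z.im - t| ≤ 2 * Real.exp ((z.im - t) ^ 2) := by
        nlinarith [sq_abs (z.im - t), sq_nonneg (|z.im - t| - 1)]
      calc 1 + |z.im| ≤ (1 + |t|) * (1 + |z.im - t|) := by
            nlinarith [mul_nonneg (abs_nonneg t) (abs_nonneg (z.im - t))]
        _ ≤ _ := by gcongr
    calc _ ≤ (1 + |z.im|) * 2 * Real.exp (z.re ^ 2 - (z.im - t) ^ 2) := by gcongr
      _ ≤ (1 + |t|) * (2 * Real.exp ((z.im - t) ^ 2)) * 2 *
          Real.exp (z.re ^ 2 - (z.im - t) ^ 2) := by gcongr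
      _ = 4 * (Real.exp ((z.im - t) ^ 2) * Real.exp (z.re ^ 2 - (z.im - t) ^ 2)) * (1 + |t|) := by
          ring
      _ = _ := by rw [← Real.exp_add, hz']; norm_num
  have h3 := HadamardThreeLines.norm_le_interp_of_mem_verticalClosedStrip' (by norm_num)
    (z := (σ + t * I : ℂ)) (by simpa [HadamardThreeLines.verticalClosedStrip] using hσ) hdcl hbdd
    hl hr
  have hre : (σ + t * I : ℂ).re = σ := by simp
  rw [hre, show (σ - 1 / 2) / (3 / 2 - 1 / 2) = σ - 1 / 2 by norm_num,
    Real.mul_rpow (x := 4 * Real.exp (9 / 4)) (y := 1 + |t|) (by positivity) (by positivity),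
    ← mul_assoc, ← Real.rpow_add (by positivity), sub_add_cancel, Real.rpow_one] at h3
  have h4 : ‖Gamma (σ + t * I) * cos (Real.pi * (σ + t * I) / 2)‖ ≤ ‖G (σ + t * I)‖ := by
    simp only [hG]
    rw [norm_mul _ (exp _), hexp]
    refine le_mul_of_one_le_right (norm_nonneg _) (Real.one_le_exp ?_)
    simp
    positivity
  refine h4.trans (h3.trans ?_)
  gcongr
  norm_num

lemma norm_riemannZeta_reflect_le {σ : ℝ} (hσ : σ ∈ Set.Ioo (1 / 2 : ℝ) 1) (t : ℝ) :
    ‖riemannZeta ((1 - σ : ℝ) + t * I)‖ ≤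
      8 * Real.exp 3 * (1 + |t|) ^ (σ - 1 / 2) * ‖riemannZeta (σ + t * I)‖ := by
  set s : ℂ := σ + (-t : ℝ) * I with hs
  have hsre : s.re = σ := by simp [hs]
  have h := riemannZeta_one_sub (s := s)
    (fun n hn ↦ by
      have h0 := congrArg re hn
      rw [hsre, neg_re, natCast_re] at h0
      have := n.cast_nonneg (α := ℝ)
      linarith [hσ.1])
    (fun hn ↦ by
      have h0 := congrArg re hn
      rw [hsre, one_re] at h0
      linarith [hσ.2])
  have e1 : ((1 - σ : ℝ) + t * I : ℂ) = 1 - s := by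
    simp [hs]
    ring
  have e2 : ‖riemannZeta (σ + t * I)‖ = ‖riemannZeta s‖ := by
    have : s = (starRingEnd ℂ) (σ + t * I) := by simp [hs]
    rw [this, riemannZeta_conj, RCLike.norm_conj]
  have h2 := norm_Gamma_mul_cos_le ⟨hσ.1.le, by linarith [hσ.2]⟩ (-t) (σ := σ)
  rw [← hs, abs_neg] at h2
  have h3 : ‖(2 * Real.pi : ℂ) ^ (-s)‖ ≤ 1 := by
    have := norm_cpow_eq_rpow_re_of_pos (x := 2 * Real.pi) (by positivity) (-s)
    push_cast at this
    rw [this, neg_re, hsre]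
    apply Real.rpow_le_one_of_one_le_of_nonpos
    · linarith [Real.pi_gt_three]
    · linarith [hσ.1]
  rw [e1, h, e2, mul_assoc _ (Gamma s), norm_mul, norm_mul, norm_mul]
  refine mul_le_mul_of_nonneg_right ?_ (norm_nonneg _)
  calc ‖(2 : ℂ)‖ * ‖(2 * Real.pi : ℂ) ^ (-s)‖ * ‖Gamma s * cos (Real.pi * s / 2)‖
      ≤ 2 * 1 * (4 * Real.exp 3 * (1 + |t|) ^ (σ - 1 / 2)) :=
        mul_le_mul (mul_le_mul (by simp) h3 (norm_nonneg _) zero_le_two) h2 (norm_nonneg _)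
          (by norm_num)
    _ = _ := by ring

lemma mellin_fract_differentiableAt {s : ℂ} (hs : 0 < s.re) :
    DifferentiableAt ℂ (fun z ↦ mellin
      ((Set.Ioi (1 : ℝ)).indicator fun t ↦ ((Int.fract t : ℝ) : ℂ)) (-z)) s := by
  have hle : ∀ t : ℝ, ‖(Set.Ioi (1 : ℝ)).indicator (fun t ↦ ((Int.fract t : ℝ) : ℂ)) t‖ ≤ 1 := by
    intro t
    rw [Set.indicator_apply]
    split_ifs
    · rw [norm_real, Real.norm_of_nonneg (Int.fract_nonneg _)]
      exact (Int.fract_lt_one t).le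
    · simp
  have hm : Measurable ((Set.Ioi (1 : ℝ)).indicator fun t ↦ ((Int.fract t : ℝ) : ℂ)) :=
    (measurable_ofReal.comp measurable_fract).indicator measurableSet_Ioi
  refine DifferentiableAt.comp (g := mellin ((Set.Ioi (1 : ℝ)).indicator fun t ↦
    ((Int.fract t : ℝ) : ℂ))) (f := fun z ↦ -z) s (mellin_differentiableAt_of_isBigO_rpow (a := 0)
    (b := -s.re - 1) ?_ ?_ ?_ ?_ ?_) (by fun_prop)
  · refine MeasureTheory.LocallyIntegrable.locallyIntegrableOn ?_ _
    exact (MeasureTheory.locallyIntegrable_const (1 : ℝ)).mono hm.aestronglyMeasurable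
      (Filter.Eventually.of_forall fun t ↦ by simpa using hle t)
  · refine Asymptotics.IsBigO.of_bound 1 (Filter.Eventually.of_forall fun t ↦ ?_)
    simpa using hle t
  · simpa using hs
  · refine (Filter.EventuallyEq.trans_isBigO (f₂ := fun _ ↦ (0 : ℂ)) ?_
      (Asymptotics.isBigO_zero _ _))
    filter_upwards [nhdsWithin_le_nhds (Iio_mem_nhds (zero_lt_one' ℝ))] with t ht
    exact Set.indicator_of_notMem (not_lt.mpr (le_of_lt ht)) _
  · simp

lemma mellin_fract_eq (s : ℂ) :
    mellin ((Set.Ioi (1 : ℝ)).indicator fun t ↦ ((Int.fract t : ℝ) : ℂ)) (-s) =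
      ∫ t in Set.Ioi (1 : ℝ), ((Int.fract t : ℝ) : ℂ) * (t : ℂ) ^ (-(s + 1)) := by
  rw [mellin, ← MeasureTheory.integral_indicator measurableSet_Ioi,
    ← MeasureTheory.integral_indicator measurableSet_Ioi]
  congr 1
  ext t
  by_cases ht : 1 < t
  · rw [Set.indicator_of_mem (show t ∈ Set.Ioi (0 : ℝ) from zero_lt_one.trans ht),
      Set.indicator_of_mem (show t ∈ Set.Ioi (1 : ℝ) from ht),
      Set.indicator_of_mem (show t ∈ Set.Ioi (1 : ℝ) from ht), smul_eq_mul, mul_comm]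
    ring_nf
  · have h1 : t ∉ Set.Ioi (1 : ℝ) := ht
    simp [Set.indicator_apply, ht]

lemma norm_mellin_fract_le {s : ℂ} (hs : 0 < s.re) :
    ‖mellin ((Set.Ioi (1 : ℝ)).indicator fun t ↦ ((Int.fract t : ℝ) : ℂ)) (-s)‖ ≤ 1 / s.re := by
  rw [mellin_fract_eq]
  have h1 : -s.re - 1 < -1 := by linarith
  calc _ ≤ ∫ t in Set.Ioi (1 : ℝ), t ^ (-s.re - 1) := by
        refine MeasureTheory.norm_integral_le_of_norm_le
          (integrableOn_Ioi_rpow_of_lt h1 zero_lt_one) ?_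
        refine (MeasureTheory.ae_restrict_mem measurableSet_Ioi).mono fun t ht ↦ ?_
        rw [norm_mul, norm_real, Real.norm_of_nonneg (Int.fract_nonneg _),
          norm_cpow_eq_rpow_re_of_pos (zero_lt_one.trans ht)]
        rw [show (-(s + 1)).re = -s.re - 1 by simp; ring]
        exact mul_le_of_le_one_left (Real.rpow_nonneg (zero_lt_one.trans ht).le _)
          (Int.fract_lt_one t).le
    _ = _ := by
        rw [integral_Ioi_rpow_of_lt h1 zero_lt_one]
        simp [neg_div]

lemma riemannZeta₁_eq_of_one_lt_re {s : ℂ} (hs : 1 < s.re) :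
    riemannZeta₁ s = s - s * (s - 1) *
      mellin ((Set.Ioi (1 : ℝ)).indicator fun t ↦ ((Int.fract t : ℝ) : ℂ)) (-s) := by
  have hs1 : s ≠ 1 := fun h ↦ by simp [h] at hs
  have hs1' : s - 1 ≠ 0 := sub_ne_zero.mpr hs1
  have h := LSeries_eq_mul_integral' (fun _ ↦ 1) zero_le_one hs
    (by
      refine Asymptotics.IsBigO.of_bound 1 (Filter.Eventually.of_forall fun n ↦ ?_)
      simp)
  rw [show LSeries (fun _ ↦ 1) s = riemannZeta s from LSeries_one_eq_riemannZeta hs,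
    riemannZeta_eq_inv_sub_mul hs1] at h
  have hlt : (-s).re < -1 := by simpa using hs
  have hlt' : (-(s + 1)).re < -1 := by simp; linarith
  have e : ∫ t in Set.Ioi (1 : ℝ), (∑ k ∈ Finset.Icc 1 ⌊t⌋₊, (1 : ℂ)) * (t : ℂ) ^ (-(s + 1)) =
      (∫ t in Set.Ioi (1 : ℝ), (t : ℂ) ^ (-s)) -
        ∫ t in Set.Ioi (1 : ℝ), ((Int.fract t : ℝ) : ℂ) * (t : ℂ) ^ (-(s + 1)) := by
    rw [← MeasureTheory.integral_sub (integrableOn_Ioi_cpow_of_lt hlt zero_lt_one)]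
    · refine MeasureTheory.setIntegral_congr_fun measurableSet_Ioi fun t ht ↦ ?_
      have ht0 : (0 : ℝ) < t := zero_lt_one.trans ht
      have e1 : (t : ℂ) ^ (-s) = t * (t : ℂ) ^ (-(s + 1)) := by
        rw [show -s = 1 + -(s + 1) by ring, cpow_add _ _ (ofReal_ne_zero.mpr ht0.ne'), cpow_one]
      have e2 : (⌊t⌋₊ : ℂ) = t - (Int.fract t : ℝ) := by
        have := Int.self_sub_fract t
        have h3 : ((⌊t⌋₊ : ℤ)) = ⌊t⌋ := Int.natCast_floor_eq_floor ht0.le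
        rw [← h3] at this
        exact_mod_cast this.symm
      simp only [Finset.sum_const, Nat.card_Icc, nsmul_eq_mul, mul_one, Nat.add_sub_cancel]
      rw [e1, e2]
      ring
    · refine (integrableOn_Ioi_cpow_of_lt hlt' zero_lt_one).bdd_mul (c := 1)
        (measurable_ofReal.comp measurable_fract).aestronglyMeasurable
        (Filter.Eventually.of_forall fun t ↦ ?_)
      rw [norm_real, Real.norm_of_nonneg (Int.fract_nonneg _)]
      exact (Int.fract_lt_one t).le
  rw [e, integral_Ioi_cpow_of_lt hlt zero_lt_one, ← mellin_fract_eq] at h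
  have h2 : -s + 1 ≠ 0 := by rwa [neg_add_eq_sub, ← neg_sub, neg_ne_zero]
  rw [inv_mul_eq_iff_eq_mul₀ hs1'] at h
  rw [h]
  simp only [ofReal_one, one_cpow]
  field_simp
  ring

lemma riemannZeta₁_eq_of_re_pos {s : ℂ} (hs : 0 < s.re) :
    riemannZeta₁ s = s - s * (s - 1) *
      mellin ((Set.Ioi (1 : ℝ)).indicator fun t ↦ ((Int.fract t : ℝ) : ℂ)) (-s) := by
  have hopen : IsOpen {z : ℂ | 0 < z.re} := isOpen_lt continuous_const continuous_re
  have hpre : IsPreconnected {z : ℂ | 0 < z.re} := (convex_halfSpace_re_gt 0).isPreconnected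
  refine AnalyticOnNhd.eqOn_of_preconnected_of_eventuallyEq
    (f := riemannZeta₁) (g := fun s ↦ s - s * (s - 1) *
      mellin ((Set.Ioi (1 : ℝ)).indicator fun t ↦ ((Int.fract t : ℝ) : ℂ)) (-s)) (z₀ := 2)
    (differentiable_riemannZeta₁.differentiableOn.analyticOnNhd hopen)
    (DifferentiableOn.analyticOnNhd (fun z hz ↦ ?_) hopen) hpre (by simp) ?_ hs
  · have := mellin_fract_differentiableAt hz
    exact DifferentiableAt.differentiableWithinAt (by fun_prop)
  · have : {z : ℂ | 1 < z.re} ∈ nhds (2 : ℂ) :=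
      (isOpen_lt continuous_const continuous_re).mem_nhds (by simp)
    filter_upwards [this] with z hz using riemannZeta₁_eq_of_one_lt_re hz

lemma norm_riemannZeta₁_le {s : ℂ} (hs : 0 < s.re) :
    ‖riemannZeta₁ s‖ ≤ ‖s‖ * (1 + ‖s - 1‖ / s.re) := by
  rw [riemannZeta₁_eq_of_re_pos hs]
  refine (norm_sub_le _ _).trans ?_
  rw [norm_mul, norm_mul, mul_add, mul_one, mul_assoc]
  have := norm_mellin_fract_le hs
  gcongr
  rw [← mul_one_div]
  gcongr

lemma Nat.card_divisors_mul_le (m n : ℕ) :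
    (m * n).divisors.card ≤ m.divisors.card * n.divisors.card := by
  open scoped Pointwise in
  rw [Nat.divisors_mul]
  exact Finset.card_mul_le

lemma one_convolution_one_apply (n : ℕ) :
    LSeries.convolution (1 : ℕ → ℂ) 1 n = (n.divisors.card : ℂ) := by
  rw [LSeries.convolution_def]
  simp [← Nat.map_div_right_divisors]

lemma LSeriesHasSum_card_divisors {s : ℂ} (hs : 1 < s.re) :
    LSeriesHasSum (fun n ↦ (n.divisors.card : ℂ)) s (riemannZeta s ^ 2) := by
  have h := (LSeriesHasSum_one hs).convolution (LSeriesHasSum_one hs)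
  rw [← sq] at h
  convert h using 1
  ext n
  exact (one_convolution_one_apply n).symm

lemma summable_card_divisors_sq {y : ℝ} (hy : 1 < y) :
    Summable fun n : ℕ ↦ (n.divisors.card : ℝ) ^ 2 * (n : ℝ) ^ (-y) := by
  have hs : 1 < (y : ℂ).re := by simpa
  have h := (LSeriesHasSum_card_divisors hs).LSeriesSummable
  have h2 := (h.convolution h).norm
  refine Summable.of_nonneg_of_le (fun n ↦ by positivity) (fun n ↦ ?_) h2
  rcases eq_or_ne n 0 with rfl | hn
  · simp
  rw [LSeries.term_of_ne_zero hn, norm_div, norm_natCast_cpow_of_pos (Nat.pos_of_ne_zero hn),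
    ofReal_re, Real.rpow_neg n.cast_nonneg, ← div_eq_mul_inv]
  gcongr
  rw [LSeries.convolution_def]
  have e : ∑ p ∈ n.divisorsAntidiagonal, (p.1.divisors.card : ℂ) * (p.2.divisors.card : ℂ) =
      ((∑ p ∈ n.divisorsAntidiagonal, p.1.divisors.card * p.2.divisors.card : ℕ) : ℂ) := by
    push_cast
    rfl
  beta_reduce
  rw [e, norm_natCast]
  norm_cast
  calc n.divisors.card ^ 2 = ∑ p ∈ n.divisorsAntidiagonal, n.divisors.card := by
        simp [sq, ← Nat.map_div_right_divisors]
    _ ≤ _ := by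
        refine Finset.sum_le_sum fun p hp ↦ ?_
        rw [← (Nat.mem_divisorsAntidiagonal.mp hp).1]
        exact Nat.card_divisors_mul_le _ _

lemma integral_norm_sq_sum_exp_mul_gaussian_le (S : Finset ℕ) (a : ℕ → ℂ) (l : ℕ → ℝ) {b : ℝ}
    (hb : 0 < b) :
    MeasureTheory.Integrable
      (fun t : ℝ ↦ ‖∑ n ∈ S, a n * exp (l n * t * I)‖ ^ 2 * Real.exp (-b * t ^ 2)) ∧
    ∫ t : ℝ, ‖∑ n ∈ S, a n * exp (l n * t * I)‖ ^ 2 * Real.exp (-b * t ^ 2) ≤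
      √(Real.pi / b) * ∑ m ∈ S, ∑ n ∈ S,
        ‖a m‖ * ‖a n‖ * Real.exp (-(l m - l n) ^ 2 / (4 * b)) := by
  have hb' : 0 < (b : ℂ).re := by simpa
  have hint : ∀ c : ℝ, MeasureTheory.Integrable
      (fun t : ℝ ↦ exp (I * c * t) * exp (-b * t ^ 2)) := fun c ↦ by
    have := (integrable_cexp_quadratic' (b := (-b : ℂ)) (by simpa) (I * c) 0)
    refine this.congr (Filter.Eventually.of_forall fun t ↦ ?_)
    simp only [← Complex.exp_add]
    ring_nf
  have hF : ∀ t : ℝ, ((‖∑ n ∈ S, a n * exp (l n * t * I)‖ ^ 2 * Real.exp (-b * t ^ 2) : ℝ) : ℂ) =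
      ∑ m ∈ S, ∑ n ∈ S, (a m * (starRingEnd ℂ) (a n)) *
        (exp (I * (l m - l n : ℝ) * t) * exp (-b * t ^ 2)) := fun t ↦ by
    have h1 : ((‖∑ n ∈ S, a n * exp (l n * t * I)‖ ^ 2 : ℝ) : ℂ) =
        (∑ n ∈ S, a n * exp (l n * t * I)) *
          (starRingEnd ℂ) (∑ n ∈ S, a n * exp (l n * t * I)) := by
      rw [mul_conj, normSq_eq_norm_sq]
    rw [ofReal_mul, h1, map_sum, Finset.sum_mul_sum, Finset.sum_mul]
    refine Finset.sum_congr rfl fun m _ ↦ ?_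
    rw [Finset.sum_mul]
    refine Finset.sum_congr rfl fun n _ ↦ ?_
    have h2 : exp (I * (l m - l n : ℝ) * t) =
        exp (l m * t * I) * (starRingEnd ℂ) (exp (l n * t * I)) := by
      rw [← exp_conj, ← Complex.exp_add]
      congr 1
      simp
      ring
    rw [h2, map_mul]
    push_cast
    ring
  have hintF : MeasureTheory.Integrable (fun t : ℝ ↦
      ((‖∑ n ∈ S, a n * exp (l n * t * I)‖ ^ 2 * Real.exp (-b * t ^ 2) : ℝ) : ℂ)) := by
    simp_rw [hF]
    exact MeasureTheory.integrable_finsetSum _ fun m _ ↦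
      MeasureTheory.integrable_finsetSum _ fun n _ ↦ (hint _).const_mul _
  refine ⟨hintF.re, ?_⟩
  refine (le_abs_self _).trans ?_
  rw [← Real.norm_eq_abs, ← norm_real, ← integral_complex_ofReal]
  simp_rw [hF]
  rw [MeasureTheory.integral_finsetSum _ fun m _ ↦
      MeasureTheory.integrable_finsetSum _ fun n _ ↦ (hint _).const_mul _, Finset.mul_sum]
  refine (norm_sum_le _ _).trans (Finset.sum_le_sum fun m _ ↦ ?_)
  rw [MeasureTheory.integral_finsetSum _ fun n _ ↦ (hint _).const_mul _, Finset.mul_sum]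
  refine (norm_sum_le _ _).trans (Finset.sum_le_sum fun n _ ↦ ?_)
  rw [MeasureTheory.integral_const_mul, fourierIntegral_gaussian hb']
  have e1 : ((Real.pi : ℂ) / b) ^ (1 / 2 : ℂ) = ((√(Real.pi / b) : ℝ) : ℂ) := by
    rw [Real.sqrt_eq_rpow, ofReal_cpow (by positivity)]
    push_cast
    rfl
  have e2 : exp (-((l m - l n : ℝ) : ℂ) ^ 2 / (4 * b)) =
      ((Real.exp (-(l m - l n) ^ 2 / (4 * b)) : ℝ) : ℂ) := by
    push_cast
    rfl
  rw [e1, e2, norm_mul, norm_mul, norm_mul, norm_real, norm_real, RCLike.norm_conj,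
    Real.norm_of_nonneg (Real.sqrt_nonneg _), Real.norm_of_nonneg (Real.exp_nonneg _)]
  exact le_of_eq (by ring)

lemma sum_range_inv_one_add_sq_le {b : ℝ} (hb : 0 < b) (N : ℕ) :
    ∑ k ∈ Finset.range N, 1 / (1 + b ^ 2 * (k : ℝ) ^ 2) ≤ 1 + 2 / b := by
  have h : ∀ N : ℕ, ∑ k ∈ Finset.range (N + 1), 1 / (1 + b ^ 2 * (k : ℝ) ^ 2) ≤
      1 + 2 / b * (1 - 1 / (1 + b * N)) := by
    intro N
    induction N with
    | zero => simp
    | succ N ih =>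
      rw [Finset.sum_range_succ]
      have : 1 / (1 + b ^ 2 * ((N + 1 : ℕ) : ℝ) ^ 2) ≤
          2 / b * (1 / (1 + b * N) - 1 / (1 + b * (N + 1 : ℕ))) := by
        have e : 2 / b * (1 / (1 + b * N) - 1 / (1 + b * (N + 1 : ℕ))) =
            2 / ((1 + b * N) * (1 + b * (N + 1 : ℕ))) := by
          push_cast
          field_simp
          ring
        rw [e, div_le_div_iff₀ (by positivity) (by positivity)]
        push_cast
        have := N.cast_nonneg (α := ℝ)
        nlinarith [sq_nonneg (b * (N + 1) - 1), mul_pos hb hb, mul_nonneg hb.le this]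
      linarith
  refine (Finset.sum_le_sum_of_subset_of_nonneg (Finset.range_mono (Nat.le_succ N))
    fun _ _ _ ↦ by positivity).trans ((h N).trans ?_)
  gcongr
  apply mul_le_of_le_one_right (by positivity)
  have : 0 ≤ 1 / (1 + b * (N : ℝ)) := by positivity
  linarith

lemma sum_inv_one_add_sq_sub_le {b : ℝ} (hb : 0 < b) (S : Finset ℕ) (m : ℕ) :
    ∑ n ∈ S, 1 / (1 + b ^ 2 * ((n : ℝ) - m) ^ 2) ≤ 2 + 4 / b := by
  have hS : S ⊆ Finset.range (m + (S.sup id + 1)) := fun n hn ↦ by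
    have : n ≤ S.sup id := Finset.le_sup (f := id) hn
    rw [Finset.mem_range]
    omega
  refine (Finset.sum_le_sum_of_subset_of_nonneg hS fun _ _ _ ↦ by positivity).trans ?_
  rw [Finset.sum_range_add, ← Finset.sum_range_reflect]
  have h1 : ∑ j ∈ Finset.range m, 1 / (1 + b ^ 2 * (((m - 1 - j : ℕ) : ℝ) - m) ^ 2) ≤
      1 + 2 / b := by
    refine (Finset.sum_le_sum fun j hj ↦ ?_).trans (sum_range_inv_one_add_sq_le hb m)
    have hj' := Finset.mem_range.mp hj
    have e : ((m - 1 - j : ℕ) : ℝ) = m - 1 - j := by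
      rw [Nat.cast_sub (by omega), Nat.cast_sub (by omega), Nat.cast_one]
    rw [e]
    gcongr 1 / (1 + b ^ 2 * ?_)
    nlinarith [j.cast_nonneg (α := ℝ)]
  have h2 : ∑ j ∈ Finset.range (S.sup id + 1), 1 / (1 + b ^ 2 * (((m + j : ℕ) : ℝ) - m) ^ 2) ≤
      1 + 2 / b := by
    refine le_trans (le_of_eq ?_) (sum_range_inv_one_add_sq_le hb (S.sup id + 1))
    simp
  calc _ ≤ 1 + 2 / b + (1 + 2 / b) := add_le_add h1 h2
    _ = _ := by ring

lemma exp_neg_sq_log_le {T : ℝ} (hT : 1 ≤ T) {m n : ℝ} (hm : 0 < m) (hn : 0 < n) :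
    Real.exp (-(T ^ 2 * (Real.log m - Real.log n) ^ 2 / 8)) ≤
      (1 + 16 * Real.exp 16) * (1 / (1 + (T / m) ^ 2 * (n - m) ^ 2)) := by
  set x := Real.log n - Real.log m with hx
  have e1 : (Real.log m - Real.log n) ^ 2 = x ^ 2 := by ring
  have e2 : n / m = Real.exp x := by
    rw [hx, Real.exp_sub, Real.exp_log hn, Real.exp_log hm]
  have e3 : (T / m) ^ 2 * (n - m) ^ 2 = T ^ 2 * (Real.exp x - 1) ^ 2 := by
    rw [← e2]
    field_simp
  rw [e1, e3, mul_one_div, le_div_iff₀ (by positivity), mul_add, mul_one]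
  refine add_le_add (Real.exp_le_one_iff.mpr (by simp; positivity)) ?_
  have h1 : (Real.exp x - 1) ^ 2 ≤ x ^ 2 * Real.exp (2 * |x|) := by
    have : |Real.exp x - 1| ≤ |x| * Real.exp |x| := by
      have a1 := Real.add_one_le_exp x
      have a2 := Real.add_one_le_exp (-x)
      have a3 : Real.exp x * Real.exp (-x) = 1 := by rw [← Real.exp_add]; simp
      rcases le_total 0 x with h | h
      · rw [abs_of_nonneg h, abs_of_nonneg (by linarith)]
        nlinarith [Real.exp_pos x]
      · have : Real.exp x ≤ 1 := Real.exp_le_one_iff.mpr h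
        rw [abs_of_nonpos h, abs_of_nonpos (by linarith)]
        nlinarith [Real.one_le_exp (neg_nonneg.mpr h)]
    rw [← sq_abs (Real.exp x - 1), ← sq_abs x, two_mul, Real.exp_add, ← sq, ← mul_pow]
    gcongr
  have h2 : T ^ 2 * x ^ 2 ≤ 16 * Real.exp (T ^ 2 * x ^ 2 / 16) := by
    have := Real.add_one_le_exp (T ^ 2 * x ^ 2 / 16)
    linarith
  calc Real.exp (-(T ^ 2 * x ^ 2 / 8)) * (T ^ 2 * (Real.exp x - 1) ^ 2)
      ≤ Real.exp (-(T ^ 2 * x ^ 2 / 8)) * (T ^ 2 * (x ^ 2 * Real.exp (2 * |x|))) := by gcongr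
    _ = Real.exp (-(T ^ 2 * x ^ 2 / 8)) * ((T ^ 2 * x ^ 2) * Real.exp (2 * |x|)) := by ring
    _ ≤ Real.exp (-(T ^ 2 * x ^ 2 / 8)) *
        ((16 * Real.exp (T ^ 2 * x ^ 2 / 16)) * Real.exp (2 * |x|)) := by gcongr
    _ = 16 * Real.exp (2 * |x| - T ^ 2 * x ^ 2 / 16) := by
        rw [show 2 * |x| - T ^ 2 * x ^ 2 / 16 =
          -(T ^ 2 * x ^ 2 / 8) + (T ^ 2 * x ^ 2 / 16 + 2 * |x|) by ring, Real.exp_add,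
          Real.exp_add]
        ring
    _ ≤ 16 * Real.exp 16 := by
        gcongr
        have : x ^ 2 ≤ T ^ 2 * x ^ 2 := le_mul_of_one_le_left (sq_nonneg _) (one_le_pow₀ hT)
        nlinarith [sq_abs x, sq_nonneg (|x| - 16)]

lemma sum_mul_mul_symm_kernel_le (S : Finset ℕ) (x : ℕ → ℝ) {k : ℕ → ℕ → ℝ}
    (hk : ∀ m n, 0 ≤ k m n) (hs : ∀ m n, k m n = k n m) :
    ∑ m ∈ S, ∑ n ∈ S, x m * x n * k m n ≤ ∑ m ∈ S, x m ^ 2 * ∑ n ∈ S, k m n := by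
  have h1 : ∑ m ∈ S, ∑ n ∈ S, x m * x n * k m n ≤
      ∑ m ∈ S, ∑ n ∈ S, (x m ^ 2 * k m n + x n ^ 2 * k m n) / 2 :=
    Finset.sum_le_sum fun m _ ↦ Finset.sum_le_sum fun n _ ↦ by
      nlinarith [mul_nonneg (sq_nonneg (x m - x n)) (hk m n)]
  have h2 : ∑ m ∈ S, ∑ n ∈ S, x n ^ 2 * k m n = ∑ m ∈ S, ∑ n ∈ S, x m ^ 2 * k m n := by
    rw [Finset.sum_comm]
    exact Finset.sum_congr rfl fun m _ ↦ Finset.sum_congr rfl fun n _ ↦ by rw [hs]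
  simp_rw [← Finset.sum_div, Finset.sum_add_distrib] at h1
  rw [h2] at h1
  simp_rw [Finset.mul_sum]
  linarith

lemma exists_meanSquare_dirichletPolynomial_le :
    ∃ C : ℝ, 0 < C ∧ ∀ T : ℝ, 1 ≤ T → ∀ (S : Finset ℕ), (∀ n ∈ S, 0 < n) →
      ∀ (c : ℕ → ℂ) (σ R : ℝ), 0 ≤ R →
      ∫ t in (-R)..R, ‖∑ n ∈ S, c n * (n : ℂ) ^ (-(σ + t * I))‖ ^ 2 *
        Real.exp (-2 * t ^ 2 / T ^ 2) ≤
      C * ∑ n ∈ S, (T + n) * (‖c n‖ * (n : ℝ) ^ (-σ)) ^ 2 := by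
  refine ⟨8 * (1 + 16 * Real.exp 16), by positivity, fun T hT S hS c σ R hR ↦ ?_⟩
  have hT0 : 0 < T := by linarith
  set x : ℕ → ℝ := fun n ↦ ‖c n‖ * (n : ℝ) ^ (-σ) with hx
  obtain ⟨hi, hle⟩ := integral_norm_sq_sum_exp_mul_gaussian_le S
    (fun n ↦ c n * ((n : ℝ) ^ (-σ) : ℝ)) (fun n ↦ -Real.log n) (b := 2 / T ^ 2) (by positivity)
  have e : ∀ t : ℝ, ‖∑ n ∈ S, c n * (n : ℂ) ^ (-(σ + t * I))‖ ^ 2 *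
      Real.exp (-2 * t ^ 2 / T ^ 2) =
      ‖∑ n ∈ S, c n * ((n : ℝ) ^ (-σ) : ℝ) * exp ((-Real.log n : ℝ) * t * I)‖ ^ 2 *
        Real.exp (-(2 / T ^ 2) * t ^ 2) := fun t ↦ by
    congr 1
    · congr 2
      refine Finset.sum_congr rfl fun n hn ↦ ?_
      have h0 : (n : ℂ) ≠ 0 := Nat.cast_ne_zero.mpr (hS n hn).ne'
      rw [mul_assoc, neg_add, cpow_add _ _ h0, ofReal_cpow n.cast_nonneg, cpow_def_of_ne_zero h0
        (-(t * I)), ← natCast_log]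
      push_cast
      ring_nf
    · congr 1
      ring
  simp_rw [e]
  rw [intervalIntegral.integral_of_le (by linarith)]
  refine (MeasureTheory.setIntegral_le_integral hi
    (Filter.Eventually.of_forall fun t ↦ by positivity)).trans (hle.trans ?_)
  have e1 : √(Real.pi / (2 / T ^ 2)) ≤ 2 * T := by
    rw [Real.sqrt_le_left (by positivity), div_div_eq_mul_div, div_le_iff₀ two_pos]
    nlinarith [Real.pi_le_four, sq_nonneg T]
  have e2 : ∀ m ∈ S, ∀ n ∈ S,
      ‖c m * ((m : ℝ) ^ (-σ) : ℝ)‖ * ‖c n * ((n : ℝ) ^ (-σ) : ℝ)‖ *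
        Real.exp (-(-Real.log m - -Real.log n) ^ 2 / (4 * (2 / T ^ 2))) =
      x m * x n * Real.exp (-(T ^ 2 * (Real.log m - Real.log n) ^ 2 / 8)) := fun m _ n _ ↦ by
    simp only [hx, norm_mul, norm_real, Real.norm_of_nonneg (Real.rpow_nonneg (Nat.cast_nonneg _) _)]
    congr 2
    field_simp
    ring
  rw [Finset.sum_congr rfl fun m hm ↦ Finset.sum_congr rfl (e2 m hm)]
  calc _ ≤ 2 * T * ∑ m ∈ S, x m ^ 2 * ∑ n ∈ S,
        Real.exp (-(T ^ 2 * (Real.log m - Real.log n) ^ 2 / 8)) := by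
        refine mul_le_mul e1 (sum_mul_mul_symm_kernel_le S x
          (k := fun m n ↦ Real.exp (-(T ^ 2 * (Real.log m - Real.log n) ^ 2 / 8)))
          (fun _ _ ↦ Real.exp_nonneg _) (fun m n ↦ ?_)) ?_ (by positivity)
        · congr 3
          ring
        · exact Finset.sum_nonneg fun _ _ ↦ Finset.sum_nonneg fun _ _ ↦ by positivity
    _ ≤ 2 * T * ∑ m ∈ S, x m ^ 2 * ((1 + 16 * Real.exp 16) * (2 + 4 / (T / m))) := by
        gcongr with m hm
        have hm0 : (0 : ℝ) < m := Nat.cast_pos.mpr (hS m hm)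
        refine (Finset.sum_le_sum fun n hn ↦ exp_neg_sq_log_le hT hm0
          (Nat.cast_pos.mpr (hS n hn))).trans ?_
        rw [← Finset.mul_sum]
        gcongr
        exact sum_inv_one_add_sq_sub_le (by positivity) S m
    _ ≤ _ := by
        rw [Finset.mul_sum, Finset.mul_sum]
        refine Finset.sum_le_sum fun m hm ↦ ?_
        have hm0 : (0 : ℝ) < m := Nat.cast_pos.mpr (hS m hm)
        have : 2 * T * (x m ^ 2 * ((1 + 16 * Real.exp 16) * (2 + 4 / (T / m)))) =
            (4 * T + 8 * m) * ((1 + 16 * Real.exp 16) * x m ^ 2) := by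
          field_simp
          ring
        rw [this]
        have h2 : 0 ≤ (1 + 16 * Real.exp 16) * x m ^ 2 := by positivity
        nlinarith

/-- The Dirichlet polynomial with divisor coefficients supported on `S`. -/
noncomputable def divisorPolynomial (S : Finset ℕ) (s : ℂ) : ℂ :=
  ∑ n ∈ S, (n.divisors.card : ℂ) * (n : ℂ) ^ (-s)

/-- The error in approximating `ζ ^ 2` by a divisor polynomial, with the pole removed and a
Gaussian weight of width `T` included. -/
noncomputable def smoothedZetaSqError (T : ℝ) (S : Finset ℕ) (s : ℂ) : ℂ :=
  (riemannZeta₁ s ^ 2 - (s - 1) ^ 2 * divisorPolynomial S s) / (s + 1) ^ 2 * exp (s ^ 2 / T ^ 2)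

lemma differentiableAt_divisorPolynomial (S : Finset ℕ) {s : ℂ} (hs : 0 < s.re) :
    DifferentiableAt ℂ (divisorPolynomial S) s := by
  have hne : -s ≠ 0 := neg_ne_zero.mpr fun h ↦ by simp [h] at hs
  unfold divisorPolynomial
  exact DifferentiableAt.fun_sum fun n _ ↦
    (differentiableAt_id.neg.const_cpow (Or.inr hne)).const_mul _

lemma norm_natCast_cpow_neg_le_one (n : ℕ) {s : ℂ} (hs : 0 < s.re) : ‖(n : ℂ) ^ (-s)‖ ≤ 1 := by
  rcases Nat.eq_zero_or_pos n with rfl | hn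
  · have hne : -s ≠ 0 := neg_ne_zero.mpr fun h ↦ by simp [h] at hs
    simp [zero_cpow hne]
  · rw [norm_natCast_cpow_of_pos hn]
    exact Real.rpow_le_one_of_one_le_of_nonpos (by exact_mod_cast hn) (by simpa using hs.le)

lemma norm_divisorPolynomial_le (S : Finset ℕ) {s : ℂ} (hs : 0 < s.re) :
    ‖divisorPolynomial S s‖ ≤ ∑ n ∈ S, (n.divisors.card : ℝ) := by
  refine (norm_sum_le _ _).trans (Finset.sum_le_sum fun n _ ↦ ?_)
  rw [norm_mul, norm_natCast]
  exact mul_le_of_le_one_right (Nat.cast_nonneg _) (norm_natCast_cpow_neg_le_one n hs)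

lemma add_one_ne_zero_of_re_pos {s : ℂ} (hs : 0 < s.re) : s + 1 ≠ 0 := fun h ↦ by
  have := congrArg re h
  simp at this
  linarith

lemma differentiableOn_smoothedZetaSqError (T : ℝ) (S : Finset ℕ) :
    DifferentiableOn ℂ (smoothedZetaSqError T S) {z | 0 < z.re} := by
  intro s hs
  have h1 := differentiableAt_divisorPolynomial S hs
  have h2 := differentiable_riemannZeta₁ s
  have h3 := pow_ne_zero 2 (add_one_ne_zero_of_re_pos hs)
  refine DifferentiableAt.differentiableWithinAt ?_
  unfold smoothedZetaSqError
  fun_prop (disch := assumption)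

lemma norm_exp_sq_div_sq (s : ℂ) (T : ℝ) :
    ‖exp (s ^ 2 / T ^ 2)‖ = Real.exp ((s.re ^ 2 - s.im ^ 2) / T ^ 2) := by
  rw [Complex.norm_exp]
  norm_cast
  rw [div_ofReal_re]
  simp [pow_two]

lemma norm_sub_one_le_norm_add_one {s : ℂ} (hs : 0 ≤ s.re) : ‖s - 1‖ ≤ ‖s + 1‖ := by
  rw [← sq_le_sq₀ (norm_nonneg _) (norm_nonneg _), ← normSq_eq_norm_sq, ← normSq_eq_norm_sq,
    normSq_apply, normSq_apply]
  simp
  nlinarith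

lemma norm_le_norm_add_one {s : ℂ} (hs : 0 ≤ s.re) : ‖s‖ ≤ ‖s + 1‖ := by
  rw [← sq_le_sq₀ (norm_nonneg _) (norm_nonneg _), ← normSq_eq_norm_sq, ← normSq_eq_norm_sq,
    normSq_apply, normSq_apply]
  simp
  nlinarith

lemma sq_add_le_mul_exp_sq {T l D : ℝ} (hT : 0 < T) (hl : 0 < l) (hD : 0 ≤ D) (a y : ℝ) :
    (a + y / l) ^ 2 + D ≤
      (2 * a ^ 2 + 2 * T ^ 2 / l ^ 2 + D) * Real.exp (y ^ 2 / T ^ 2) := by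
  have e1 : 1 ≤ Real.exp (y ^ 2 / T ^ 2) := Real.one_le_exp (by positivity)
  have e2 : y ^ 2 / T ^ 2 ≤ Real.exp (y ^ 2 / T ^ 2) := by
    have := Real.add_one_le_exp (y ^ 2 / T ^ 2)
    linarith
  have e3 : (a + y / l) ^ 2 ≤ 2 * a ^ 2 + 2 * T ^ 2 / l ^ 2 * (y ^ 2 / T ^ 2) := by
    have : 2 * T ^ 2 / l ^ 2 * (y ^ 2 / T ^ 2) = 2 * (y / l) ^ 2 := by
      field_simp
    rw [this]
    linarith [sq_nonneg (a - y / l)]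
  have e4 := mul_le_mul_of_nonneg_left e2 (by positivity : 0 ≤ 2 * T ^ 2 / l ^ 2)
  have e5 := le_mul_of_one_le_right (by positivity : 0 ≤ 2 * a ^ 2 + D) e1
  linarith

lemma exists_norm_smoothedZetaSqError_le {T : ℝ} (hT : 1 ≤ T) (S : Finset ℕ) {l u : ℝ}
    (hl : 0 < l) :
    ∃ C, ∀ z : ℂ, z.re ∈ Set.Icc l u → ‖smoothedZetaSqError T S z‖ ≤ C := by
  obtain ⟨D, hDS⟩ : ∃ D, D = ∑ n ∈ S, (n.divisors.card : ℝ) := ⟨_, rfl⟩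
  have hD : 0 ≤ D := hDS ▸ Finset.sum_nonneg fun _ _ ↦ Nat.cast_nonneg _
  obtain ⟨a, ha⟩ : ∃ a, a = 1 + (u + 1) / l := ⟨_, rfl⟩
  refine ⟨(2 * a ^ 2 + 2 * T ^ 2 / l ^ 2 + D) * Real.exp (u ^ 2), fun z hz ↦ ?_⟩
  have hz0 : 0 < z.re := hl.trans_le hz.1
  have hu : 0 < u := hz0.trans_le hz.2
  have hT0 : 0 < T := by linarith
  have hn := norm_pos_iff.mpr (add_one_ne_zero_of_re_pos hz0)
  rw [smoothedZetaSqError, norm_mul, norm_exp_sq_div_sq]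
  have h1 : ‖riemannZeta₁ z‖ ≤ ‖z + 1‖ * (a + |z.im| / l) := by
    refine (norm_riemannZeta₁_le hz0).trans ?_
    have h2 : ‖z - 1‖ ≤ u + 1 + |z.im| := by
      refine (norm_le_abs_re_add_abs_im _).trans ?_
      simp only [sub_re, one_re, sub_im, one_im, sub_zero]
      gcongr
      rw [abs_le]
      constructor <;> linarith [hz.2]
    refine mul_le_mul (norm_le_norm_add_one hz0.le) ?_ (by positivity) (norm_nonneg _)
    have h3 : ‖z - 1‖ / z.re ≤ (u + 1 + |z.im|) / l := by
      gcongr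
      exact hz.1
    rw [add_div] at h3
    linarith
  have h4 : ‖(riemannZeta₁ z ^ 2 - (z - 1) ^ 2 * divisorPolynomial S z) / (z + 1) ^ 2‖ ≤
      (a + |z.im| / l) ^ 2 + D := by
    rw [norm_div, norm_pow, div_le_iff₀ (by positivity)]
    refine (norm_sub_le _ _).trans ?_
    rw [norm_mul, norm_pow, norm_pow]
    have h5 := pow_le_pow_left₀ (norm_nonneg _) h1 2
    have h6 := mul_le_mul (pow_le_pow_left₀ (norm_nonneg _) (norm_sub_one_le_norm_add_one hz0.le) 2)
      ((norm_divisorPolynomial_le S hz0).trans_eq hDS.symm) (norm_nonneg _) (by positivity)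
    rw [mul_pow] at h5
    linarith
  have h7 : Real.exp ((z.re ^ 2 - z.im ^ 2) / T ^ 2) ≤
      Real.exp (u ^ 2) * Real.exp (-(z.im ^ 2 / T ^ 2)) := by
    rw [← Real.exp_add, Real.exp_le_exp, sub_div, ← sub_eq_add_neg]
    gcongr
    calc z.re ^ 2 / T ^ 2 ≤ z.re ^ 2 := div_le_self (sq_nonneg _) (one_le_pow₀ hT)
      _ ≤ u ^ 2 := by
        gcongr
        exact hz.2
  have h8 := sq_add_le_mul_exp_sq hT0 hl hD a |z.im|
  rw [sq_abs] at h8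
  calc _ ≤ (2 * a ^ 2 + 2 * T ^ 2 / l ^ 2 + D) * Real.exp (z.im ^ 2 / T ^ 2) *
        (Real.exp (u ^ 2) * Real.exp (-(z.im ^ 2 / T ^ 2))) :=
        mul_le_mul (h4.trans h8) h7 (Real.exp_nonneg _) (by positivity)
    _ = (2 * a ^ 2 + 2 * T ^ 2 / l ^ 2 + D) * Real.exp (u ^ 2) *
        (Real.exp (z.im ^ 2 / T ^ 2) * Real.exp (-(z.im ^ 2 / T ^ 2))) := by ring
    _ = _ := by rw [← Real.exp_add]; simp

lemma norm_smoothedZetaSqError_sq (T : ℝ) (S : Finset ℕ) (x t : ℝ) (h1 : (x + t * I : ℂ) ≠ 1) :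
    ‖smoothedZetaSqError T S (x + t * I)‖ ^ 2 =
      (‖(x + t * I - 1 : ℂ)‖ / ‖(x + t * I + 1 : ℂ)‖) ^ 4 * Real.exp (2 * x ^ 2 / T ^ 2) *
        (‖riemannZeta (x + t * I) ^ 2 - divisorPolynomial S (x + t * I)‖ ^ 2 *
          Real.exp (-2 * t ^ 2 / T ^ 2)) := by
  have hne : (x + t * I - 1 : ℂ) ≠ 0 := sub_ne_zero.mpr h1
  have e : riemannZeta₁ (x + t * I) = (x + t * I - 1) * riemannZeta (x + t * I) := by
    rw [riemannZeta_eq_inv_sub_mul h1, mul_inv_cancel_left₀ hne]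
  rw [smoothedZetaSqError, e, mul_pow, ← mul_sub, norm_mul, norm_div, norm_mul,
    norm_exp_sq_div_sq, norm_pow, norm_pow]
  have e2 : Real.exp (((x + t * I : ℂ).re ^ 2 - (x + t * I : ℂ).im ^ 2) / T ^ 2) ^ 2 =
      Real.exp (2 * x ^ 2 / T ^ 2) * Real.exp (-2 * t ^ 2 / T ^ 2) := by
    rw [← Real.exp_add, ← Real.exp_nat_mul]
    congr 1
    simp
    ring
  rw [mul_pow, e2]
  ring

lemma norm_smoothedZetaSqError_sq_le {T : ℝ} (hT : 1 ≤ T) (S : Finset ℕ) {x u : ℝ} (hx : 0 < x)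
    (hx1 : x ≠ 1) (hu : x ≤ u) (t : ℝ) :
    ‖smoothedZetaSqError T S (x + t * I)‖ ^ 2 ≤ Real.exp (2 * u ^ 2) *
        (‖riemannZeta (x + t * I) ^ 2 - divisorPolynomial S (x + t * I)‖ ^ 2 *
          Real.exp (-2 * t ^ 2 / T ^ 2)) := by
  have h1 : (x + t * I : ℂ) ≠ 1 := fun h ↦ hx1 (by simpa using congrArg re h)
  rw [norm_smoothedZetaSqError_sq T S x t h1]
  gcongr
  rw [← one_mul (Real.exp (2 * u ^ 2))]
  gcongr
  · apply pow_le_one₀ (by positivity)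
    exact div_le_one_of_le₀ (norm_sub_one_le_norm_add_one (by simpa using hx.le)) (norm_nonneg _)
  · calc 2 * x ^ 2 / T ^ 2 ≤ 2 * x ^ 2 := div_le_self (by positivity) (one_le_pow₀ hT)
      _ ≤ 2 * u ^ 2 := by gcongr

lemma mul_le_norm_smoothedZetaSqError_sq (T : ℝ) (S : Finset ℕ) {x t c : ℝ} (hx : 0 < x)
    (h1 : (x + t * I : ℂ) ≠ 1) (hc : 0 ≤ c)
    (h : c * ‖(x + t * I + 1 : ℂ)‖ ≤ ‖(x + t * I - 1 : ℂ)‖) :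
    c ^ 4 * (‖riemannZeta (x + t * I) ^ 2 - divisorPolynomial S (x + t * I)‖ ^ 2 *
      Real.exp (-2 * t ^ 2 / T ^ 2)) ≤ ‖smoothedZetaSqError T S (x + t * I)‖ ^ 2 := by
  rw [norm_smoothedZetaSqError_sq T S x t h1]
  gcongr
  have h0 : 0 < ‖(x + t * I + 1 : ℂ)‖ :=
    norm_pos_iff.mpr (add_one_ne_zero_of_re_pos (by simpa using hx))
  rw [← mul_one (c ^ 4)]
  gcongr
  · rwa [le_div_iff₀ h0]
  · exact Real.one_le_exp (by positivity)

lemma exists_meanSquare_divisorPolynomial_le :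
    ∃ C : ℝ, 0 < C ∧ ∀ T : ℝ, 1 ≤ T → ∀ (S : Finset ℕ), (∀ n ∈ S, 0 < n) →
      ∀ (x R : ℝ), 0 ≤ R →
      ∫ t in (-R)..R, ‖divisorPolynomial S (x + t * I)‖ ^ 2 * Real.exp (-2 * t ^ 2 / T ^ 2) ≤
      C * ∑ n ∈ S, (T + n) * ((n.divisors.card : ℝ) ^ 2 * (n : ℝ) ^ (-(2 * x))) := by
  obtain ⟨C, hC, h⟩ := exists_meanSquare_dirichletPolynomial_le
  refine ⟨C, hC, fun T hT S hS x R hR ↦ (h T hT S hS _ x R hR).trans_eq ?_⟩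
  congr 1
  refine Finset.sum_congr rfl fun n _ ↦ ?_
  rw [norm_natCast, mul_pow, ← Real.rpow_mul_natCast n.cast_nonneg]
  congr 3
  push_cast
  ring

lemma exists_meanSquare_divisorPolynomial_Icc_le {σ : ℝ} (hσ : 1 / 2 < σ) :
    ∃ K : ℝ, 0 < K ∧ ∀ T : ℝ, 1 ≤ T → ∀ x : ℝ, x ≤ σ → ∀ R : ℝ, 0 ≤ R →
      ∫ t in (-R)..R, ‖divisorPolynomial (Finset.Icc 1 ⌊T⌋₊) (x + t * I)‖ ^ 2 *
        Real.exp (-2 * t ^ 2 / T ^ 2) ≤ K * T ^ (1 + 2 * (σ - x)) := by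
  obtain ⟨C, hC, h⟩ := exists_meanSquare_divisorPolynomial_le
  have hs := summable_card_divisors_sq (y := 2 * σ) (by linarith)
  set W := ∑' n : ℕ, (n.divisors.card : ℝ) ^ 2 * (n : ℝ) ^ (-(2 * σ)) with hW
  have hW0 : 0 ≤ W := tsum_nonneg fun n ↦ by positivity
  refine ⟨C * (2 * (W + 1)), by positivity, fun T hT x hx R hR ↦ ?_⟩
  have hT0 : 0 < T := by linarith
  refine (h T hT _ (fun n hn ↦ (Finset.mem_Icc.mp hn).1) x R hR).trans ?_
  rw [mul_assoc]
  gcongr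
  calc _ ≤ ∑ n ∈ Finset.Icc 1 ⌊T⌋₊, 2 * T ^ (1 + 2 * (σ - x)) *
        ((n.divisors.card : ℝ) ^ 2 * (n : ℝ) ^ (-(2 * σ))) := by
        refine Finset.sum_le_sum fun n hn ↦ ?_
        have hn0 : (0 : ℝ) < n := Nat.cast_pos.mpr (Finset.mem_Icc.mp hn).1
        have hnT : (n : ℝ) ≤ T := (Nat.le_floor_iff hT0.le).mp (Finset.mem_Icc.mp hn).2
        have e : (n : ℝ) ^ (-(2 * x)) ≤ T ^ (2 * (σ - x)) * (n : ℝ) ^ (-(2 * σ)) := by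
          rw [show -(2 * x) = 2 * (σ - x) + -(2 * σ) by ring, Real.rpow_add hn0]
          gcongr
        rw [Real.rpow_add hT0, Real.rpow_one]
        calc _ ≤ (T + T) * ((n.divisors.card : ℝ) ^ 2 *
              (T ^ (2 * (σ - x)) * (n : ℝ) ^ (-(2 * σ)))) := by gcongr
          _ = _ := by ring
    _ ≤ 2 * T ^ (1 + 2 * (σ - x)) * W := by
        rw [← Finset.mul_sum]
        gcongr
        exact hs.sum_le_tsum _ fun _ _ ↦ by positivity
    _ ≤ _ := by
        have : 0 ≤ T ^ (1 + 2 * (σ - x)) := by positivity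
        nlinarith

lemma tendsto_divisorPolynomial_Icc {s : ℂ} (hs : 1 < s.re) :
    Filter.Tendsto (fun N ↦ divisorPolynomial (Finset.Icc 1 N) s) Filter.atTop
      (nhds (riemannZeta s ^ 2)) := by
  have h := ((Filter.tendsto_add_atTop_iff_nat 1).mpr
    (LSeriesHasSum_card_divisors hs).tendsto_sum_nat)
  refine h.congr fun N ↦ ?_
  rw [Finset.sum_range_succ', LSeries.term_zero, add_zero, divisorPolynomial]
  induction N with
  | zero => simp
  | succ N ih =>
    rw [Finset.sum_range_succ, ih, Finset.sum_Icc_succ_top (by omega),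
      LSeries.term_of_ne_zero N.succ_ne_zero, cpow_neg, div_eq_mul_inv]

lemma divisorPolynomial_sub_of_subset {S S' : Finset ℕ} (h : S ⊆ S') (s : ℂ) :
    divisorPolynomial S' s - divisorPolynomial S s = divisorPolynomial (S' \ S) s := by
  rw [divisorPolynomial, divisorPolynomial, divisorPolynomial, Finset.sum_sdiff_eq_sub h]

lemma exists_meanSquare_zeta_sq_sub_divisorPolynomial_le {σ : ℝ} (hσ : σ ∈ Set.Ioo (1 / 2 : ℝ) 1) :
    ∃ K : ℝ, 0 < K ∧ ∀ T : ℝ, 1 ≤ T → ∀ R : ℝ, 0 ≤ R →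
      ∫ t in (-R)..R, ‖riemannZeta ((2 : ℝ) + t * I) ^ 2 -
        divisorPolynomial (Finset.Icc 1 ⌊T⌋₊) ((2 : ℝ) + t * I)‖ ^ 2 *
        Real.exp (-2 * t ^ 2 / T ^ 2) ≤ K * T ^ (2 * σ - 3) := by
  obtain ⟨C, hC, h⟩ := exists_meanSquare_divisorPolynomial_le
  have hs := summable_card_divisors_sq (y := 2 * σ) (by linarith [hσ.1])
  set W := ∑' n : ℕ, (n.divisors.card : ℝ) ^ 2 * (n : ℝ) ^ (-(2 * σ)) with hW
  have hW0 : 0 ≤ W := tsum_nonneg fun n ↦ by positivity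
  refine ⟨C * (2 * (W + 1)), by positivity, fun T hT R hR ↦ ?_⟩
  have hT0 : 0 < T := by linarith
  have hre : ∀ t : ℝ, 1 < (((2 : ℝ) : ℂ) + t * I).re := fun t ↦ by simp
  set V := ∑' n : ℕ, ‖LSeries.term (fun n ↦ (n.divisors.card : ℂ)) (2 : ℝ) n‖ with hV
  have hVs : Summable fun n : ℕ ↦ ‖LSeries.term (fun n ↦ (n.divisors.card : ℂ)) (2 : ℝ) n‖ :=
    (LSeriesHasSum_card_divisors (s := (2 : ℝ)) (by simp)).LSeriesSummable.norm
  have hbound : ∀ (S : Finset ℕ) (t : ℝ), ‖divisorPolynomial S ((2 : ℝ) + t * I)‖ ≤ V := by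
    intro S t
    refine (norm_sum_le _ _).trans ((Finset.sum_le_sum fun n _ ↦ ?_).trans
      (hVs.sum_le_tsum S fun _ _ ↦ norm_nonneg _))
    rcases Nat.eq_zero_or_pos n with rfl | hn
    · simp
    · rw [LSeries.term_of_ne_zero hn.ne', norm_mul, norm_div, norm_natCast_cpow_of_pos hn,
        norm_natCast_cpow_of_pos hn, div_eq_mul_inv, ← Real.rpow_neg n.cast_nonneg]
      simp
  have hlim : Filter.Tendsto (fun N : ℕ ↦ ∫ t in (-R)..R,
      ‖divisorPolynomial (Finset.Icc 1 N \ Finset.Icc 1 ⌊T⌋₊) ((2 : ℝ) + t * I)‖ ^ 2 *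
        Real.exp (-2 * t ^ 2 / T ^ 2)) Filter.atTop
      (nhds (∫ t in (-R)..R, ‖riemannZeta ((2 : ℝ) + t * I) ^ 2 -
        divisorPolynomial (Finset.Icc 1 ⌊T⌋₊) ((2 : ℝ) + t * I)‖ ^ 2 *
        Real.exp (-2 * t ^ 2 / T ^ 2))) := by
    refine intervalIntegral.tendsto_integral_filter_of_dominated_convergence (fun _ ↦ V ^ 2)
      (Filter.Eventually.of_forall fun N ↦ ?_) (Filter.Eventually.of_forall fun N ↦
        Filter.Eventually.of_forall fun t _ ↦ ?_) (by simp)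
      (Filter.Eventually.of_forall fun t _ ↦ ?_)
    · refine Continuous.aestronglyMeasurable ?_
      refine Continuous.mul (Continuous.pow (Continuous.norm ?_) 2) (by fun_prop)
      refine continuous_iff_continuousAt.mpr fun t ↦ ?_
      exact ContinuousAt.comp (f := fun t : ℝ ↦ ((2 : ℝ) + t * I : ℂ))
        (differentiableAt_divisorPolynomial _ (by linarith [hre t])).continuousAt (by fun_prop)
    · rw [Real.norm_of_nonneg (by positivity)]
      refine (mul_le_of_le_one_right (by positivity) (Real.exp_le_one_iff.mpr ?_)).trans
        (pow_le_pow_left₀ (norm_nonneg _) (hbound _ t) 2)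
      rw [neg_mul, neg_div]
      exact neg_nonpos.mpr (by positivity)
    · refine Filter.Tendsto.mul_const _ (Filter.Tendsto.pow (Filter.Tendsto.norm ?_) 2)
      refine ((tendsto_divisorPolynomial_Icc (hre t)).sub_const _).congr' ?_
      filter_upwards [Filter.eventually_ge_atTop ⌊T⌋₊] with N hN
      exact divisorPolynomial_sub_of_subset (Finset.Icc_subset_Icc_right hN) _
  refine le_of_tendsto' hlim fun N ↦ ?_
  have hmem : ∀ n ∈ Finset.Icc 1 N \ Finset.Icc 1 ⌊T⌋₊, T < n ∧ 0 < n := fun n hn ↦ by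
    simp only [Finset.mem_sdiff, Finset.mem_Icc, not_and, not_le] at hn
    exact ⟨(Nat.floor_lt hT0.le).mp (hn.2 hn.1.1), hn.1.1⟩
  refine (h T hT _ (fun n hn ↦ (hmem n hn).2) 2 R hR).trans ?_
  rw [mul_assoc]
  gcongr
  calc _ ≤ ∑ n ∈ Finset.Icc 1 N \ Finset.Icc 1 ⌊T⌋₊, 2 * T ^ (2 * σ - 3) *
        ((n.divisors.card : ℝ) ^ 2 * (n : ℝ) ^ (-(2 * σ))) := by
        refine Finset.sum_le_sum fun n hn ↦ ?_
        obtain ⟨hnT, hn'⟩ := hmem n hn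
        have hn0 : (0 : ℝ) < n := Nat.cast_pos.mpr hn'
        have e : (n : ℝ) * (n : ℝ) ^ (-(2 * 2) : ℝ) ≤ T ^ (2 * σ - 3) * (n : ℝ) ^ (-(2 * σ)) := by
          have : (n : ℝ) * (n : ℝ) ^ (-(2 * 2) : ℝ) =
              (n : ℝ) ^ (2 * σ - 3) * (n : ℝ) ^ (-(2 * σ)) := by
            rw [← Real.rpow_one_add' hn0.le (by norm_num), ← Real.rpow_add hn0]
            congr 1
            ring
          rw [this]
          gcongr ?_ * _
          exact Real.rpow_le_rpow_of_nonpos hT0 hnT.le (by linarith [hσ.2])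
        calc _ ≤ ((n : ℝ) + n) * ((n.divisors.card : ℝ) ^ 2 * (n : ℝ) ^ (-(2 * 2) : ℝ)) := by
              gcongr
          _ = 2 * (n.divisors.card : ℝ) ^ 2 * ((n : ℝ) * (n : ℝ) ^ (-(2 * 2) : ℝ)) := by ring
          _ ≤ 2 * (n.divisors.card : ℝ) ^ 2 * (T ^ (2 * σ - 3) * (n : ℝ) ^ (-(2 * σ))) := by
              gcongr
          _ = _ := by ring
    _ ≤ 2 * T ^ (2 * σ - 3) * W := by
        rw [← Finset.mul_sum]
        gcongr
        exact hs.sum_le_tsum _ fun _ _ ↦ by positivity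
    _ ≤ _ := by
        have : 0 ≤ T ^ (2 * σ - 3) := by positivity
        nlinarith

lemma continuous_riemannZeta_vertical {x : ℝ} (hx : x ≠ 1) :
    Continuous fun t : ℝ ↦ riemannZeta (x + t * I) := by
  refine continuous_iff_continuousAt.mpr fun t ↦ ?_
  exact ContinuousAt.comp (f := fun t : ℝ ↦ (x + t * I : ℂ))
    (differentiableAt_riemannZeta fun h ↦ hx (by simpa using congrArg re h)).continuousAt
    (by fun_prop)

lemma continuous_divisorPolynomial_vertical (S : Finset ℕ) {x : ℝ} (hx : 0 < x) :
    Continuous fun t : ℝ ↦ divisorPolynomial S (x + t * I) := by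
  refine continuous_iff_continuousAt.mpr fun t ↦ ?_
  exact ContinuousAt.comp (f := fun t : ℝ ↦ (x + t * I : ℂ))
    (differentiableAt_divisorPolynomial _ (by simpa using hx)).continuousAt (by fun_prop)

lemma continuous_smoothedZetaSqError_vertical (T : ℝ) (S : Finset ℕ) {x : ℝ} (hx : 0 < x) :
    Continuous fun t : ℝ ↦ smoothedZetaSqError T S (x + t * I) := by
  refine continuous_iff_continuousAt.mpr fun t ↦ ?_
  have hopen : IsOpen {z : ℂ | 0 < z.re} := isOpen_lt continuous_const continuous_re
  exact ContinuousAt.comp (f := fun t : ℝ ↦ (x + t * I : ℂ))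
    ((differentiableOn_smoothedZetaSqError T S).differentiableAt
      (hopen.mem_nhds (by simpa using hx))).continuousAt (by fun_prop)

lemma one_add_abs_rpow_mul_gaussian_le {T p : ℝ} (hT : 1 ≤ T) (hp0 : 0 ≤ p) (hp : p ≤ 2) (t : ℝ) :
    (1 + |t|) ^ p * Real.exp (-2 * t ^ 2 / T ^ 2) ≤
      2 * T ^ p * Real.exp (-2 * t ^ 2 / (2 * T) ^ 2) := by
  have hT0 : 0 < T := by linarith
  set u := |t| / T with hu
  have hu0 : 0 ≤ u := by positivity
  have e1 : t ^ 2 / T ^ 2 = u ^ 2 := by rw [hu, div_pow, sq_abs]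
  have h1 : (1 + |t|) ^ p ≤ T ^ p * (2 * Real.exp (u ^ 2)) := by
    have h2 : 1 + |t| ≤ T * (1 + u) := by
      rw [mul_add, hu, mul_div_cancel₀ _ hT0.ne']
      linarith
    calc (1 + |t|) ^ p ≤ (T * (1 + u)) ^ p := by gcongr
      _ = T ^ p * (1 + u) ^ p := Real.mul_rpow hT0.le (by positivity)
      _ ≤ T ^ p * (1 + u) ^ (2 : ℝ) := by
          gcongr
          exact le_add_of_nonneg_right hu0
      _ ≤ _ := by
          gcongr
          rw [Real.rpow_two]
          nlinarith [Real.add_one_le_exp (u ^ 2), sq_nonneg (u - 1)]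
  have e2 : -2 * t ^ 2 / T ^ 2 = -2 * u ^ 2 := by rw [mul_div_assoc, e1]
  have e3 : -2 * t ^ 2 / (2 * T) ^ 2 = -(u ^ 2) / 2 := by
    rw [← e1]
    field_simp
  rw [e2, e3]
  calc _ ≤ T ^ p * (2 * Real.exp (u ^ 2)) * Real.exp (-2 * u ^ 2) := by gcongr
    _ = 2 * T ^ p * Real.exp (u ^ 2 + -2 * u ^ 2) := by
        rw [Real.exp_add]
        ring
    _ ≤ _ := by
        gcongr
        nlinarith [sq_nonneg u]

lemma norm_sub_sq_le (z w : ℂ) : ‖z ^ 2 - w‖ ^ 2 ≤ 2 * (‖z‖ ^ 4 + ‖w‖ ^ 2) := by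
  have h := norm_sub_le (z ^ 2) w
  rw [norm_pow] at h
  nlinarith [sq_nonneg (‖z‖ ^ 2 - ‖w‖), norm_nonneg (z ^ 2 - w), sq_nonneg ‖z‖, norm_nonneg w]

lemma norm_pow_four_le (z w : ℂ) : ‖z‖ ^ 4 ≤ 2 * (‖z ^ 2 - w‖ ^ 2 + ‖w‖ ^ 2) := by
  have h := norm_add_le (z ^ 2 - w) w
  rw [sub_add_cancel, norm_pow] at h
  nlinarith [sq_nonneg (‖z ^ 2 - w‖ - ‖w‖), norm_nonneg (z ^ 2 - w), sq_nonneg ‖z‖, norm_nonneg w]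

lemma exists_meanSquare_smoothedZetaSqError_left_le {σ : ℝ} (hσ : σ ∈ Set.Ioo (1 / 2 : ℝ) 1) :
    ∃ C : ℝ, 0 < C ∧ ∀ T X : ℝ, 1 ≤ T → 0 ≤ X →
      (∀ R : ℝ, 0 ≤ R → ∫ t in (-R)..R, ‖riemannZeta (σ + t * I)‖ ^ 4 *
        Real.exp (-2 * t ^ 2 / (2 * T) ^ 2) ≤ X) →
      ∀ R : ℝ, 0 ≤ R →
        ∫ t in (-R)..R, ‖smoothedZetaSqError T (Finset.Icc 1 ⌊T⌋₊) ((1 - σ : ℝ) + t * I)‖ ^ 2 ≤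
          C * (T ^ (4 * σ - 2) * (X + T)) := by
  obtain ⟨K, hK, hD⟩ := exists_meanSquare_divisorPolynomial_Icc_le hσ.1
  set L := (8 * Real.exp 3) ^ 4 * 2 with hL
  have hσ1 : σ ≠ 1 := hσ.2.ne
  have hα0 : 0 < 1 - σ := by linarith [hσ.2]
  have hα1 : 1 - σ ≠ 1 := by linarith [hσ.1]
  refine ⟨Real.exp (2 * 1 ^ 2) * 2 * (L + K), by positivity, fun T X hT hX hM R hR ↦ ?_⟩
  have hT0 : 0 < T := by linarith
  set S := Finset.Icc 1 ⌊T⌋₊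
  have hζ := continuous_riemannZeta_vertical hσ1
  have hDc := continuous_divisorPolynomial_vertical S hα0
  have hpt : ∀ t : ℝ, ‖smoothedZetaSqError T S ((1 - σ : ℝ) + t * I)‖ ^ 2 ≤
      Real.exp (2 * 1 ^ 2) * 2 * (L * T ^ (4 * σ - 2) * (‖riemannZeta (σ + t * I)‖ ^ 4 *
        Real.exp (-2 * t ^ 2 / (2 * T) ^ 2)) +
        ‖divisorPolynomial S ((1 - σ : ℝ) + t * I)‖ ^ 2 * Real.exp (-2 * t ^ 2 / T ^ 2)) := by
    intro t
    refine (norm_smoothedZetaSqError_sq_le hT S hα0 hα1 (u := 1) (by linarith [hσ.1]) t).trans ?_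
    rw [mul_assoc (Real.exp _) 2]
    refine mul_le_mul_of_nonneg_left ?_ (Real.exp_nonneg _)
    have h1 := norm_sub_sq_le (riemannZeta ((1 - σ : ℝ) + t * I))
      (divisorPolynomial S ((1 - σ : ℝ) + t * I))
    have h2 := pow_le_pow_left₀ (norm_nonneg _) (norm_riemannZeta_reflect_le hσ t) 4
    have h3 := one_add_abs_rpow_mul_gaussian_le hT (p := 4 * σ - 2) (by linarith [hσ.1])
      (by linarith [hσ.2]) t
    have e4 : ((1 + |t|) ^ (σ - 1 / 2)) ^ 4 = (1 + |t|) ^ (4 * σ - 2) := by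
      rw [← Real.rpow_mul_natCast (by positivity)]
      congr 1
      push_cast
      ring
    rw [mul_pow, mul_pow, e4] at h2
    have h5 : ‖riemannZeta ((1 - σ : ℝ) + t * I)‖ ^ 4 * Real.exp (-2 * t ^ 2 / T ^ 2) ≤
        L * T ^ (4 * σ - 2) * (‖riemannZeta (σ + t * I)‖ ^ 4 *
          Real.exp (-2 * t ^ 2 / (2 * T) ^ 2)) := by
      calc _ ≤ (8 * Real.exp 3) ^ 4 * (1 + |t|) ^ (4 * σ - 2) * ‖riemannZeta (σ + t * I)‖ ^ 4 *
            Real.exp (-2 * t ^ 2 / T ^ 2) := by gcongr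
        _ = (8 * Real.exp 3) ^ 4 * ‖riemannZeta (σ + t * I)‖ ^ 4 *
            ((1 + |t|) ^ (4 * σ - 2) * Real.exp (-2 * t ^ 2 / T ^ 2)) := by ring
        _ ≤ (8 * Real.exp 3) ^ 4 * ‖riemannZeta (σ + t * I)‖ ^ 4 *
            (2 * T ^ (4 * σ - 2) * Real.exp (-2 * t ^ 2 / (2 * T) ^ 2)) := by gcongr
        _ = _ := by
            rw [hL]
            ring
    have h6 := mul_le_mul_of_nonneg_right h1 (Real.exp_nonneg (-2 * t ^ 2 / T ^ 2))
    linarith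
  calc _ ≤ ∫ t in (-R)..R, Real.exp (2 * 1 ^ 2) * 2 * (L * T ^ (4 * σ - 2) *
        (‖riemannZeta (σ + t * I)‖ ^ 4 * Real.exp (-2 * t ^ 2 / (2 * T) ^ 2)) +
        ‖divisorPolynomial S ((1 - σ : ℝ) + t * I)‖ ^ 2 * Real.exp (-2 * t ^ 2 / T ^ 2)) := by
        refine intervalIntegral.integral_mono (by linarith) ?_ ?_ hpt
        · exact (((continuous_smoothedZetaSqError_vertical T S hα0).norm).pow 2).intervalIntegrable
            _ _
        · exact Continuous.intervalIntegrable (by fun_prop) _ _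
    _ = Real.exp (2 * 1 ^ 2) * 2 * (L * T ^ (4 * σ - 2) *
        (∫ t in (-R)..R, ‖riemannZeta (σ + t * I)‖ ^ 4 * Real.exp (-2 * t ^ 2 / (2 * T) ^ 2)) +
        ∫ t in (-R)..R, ‖divisorPolynomial S ((1 - σ : ℝ) + t * I)‖ ^ 2 *
          Real.exp (-2 * t ^ 2 / T ^ 2)) := by
        rw [intervalIntegral.integral_const_mul, intervalIntegral.integral_add,
          intervalIntegral.integral_const_mul]
        · exact Continuous.intervalIntegrable (by fun_prop) _ _
        · exact Continuous.intervalIntegrable (by fun_prop) _ _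
    _ ≤ Real.exp (2 * 1 ^ 2) * 2 * (L * T ^ (4 * σ - 2) * X +
          K * T ^ (1 + 2 * (σ - (1 - σ)))) := by
        gcongr
        · exact hM R hR
        · exact hD T hT (1 - σ) (by linarith [hσ.1]) R hR
    _ ≤ _ := by
        have e : T ^ (1 + 2 * (σ - (1 - σ))) = T ^ (4 * σ - 2) * T := by
          rw [← Real.rpow_add_one hT0.ne']
          congr 1
          ring
        have hp : 0 ≤ T ^ (4 * σ - 2) := by positivity
        rw [e, mul_assoc (Real.exp (2 * 1 ^ 2) * 2)]
        gcongr
        have h1 : 0 ≤ L * (T ^ (4 * σ - 2) * T) := by positivity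
        have h2 : 0 ≤ K * (T ^ (4 * σ - 2) * X) := by positivity
        nlinarith

lemma exists_meanSquare_smoothedZetaSqError_right_le {σ : ℝ} (hσ : σ ∈ Set.Ioo (1 / 2 : ℝ) 1) :
    ∃ C : ℝ, 0 < C ∧ ∀ T : ℝ, 1 ≤ T → ∀ R : ℝ, 0 ≤ R →
        ∫ t in (-R)..R, ‖smoothedZetaSqError T (Finset.Icc 1 ⌊T⌋₊) ((2 : ℝ) + t * I)‖ ^ 2 ≤
          C * T ^ (2 * σ - 3) := by
  obtain ⟨K, hK, h⟩ := exists_meanSquare_zeta_sq_sub_divisorPolynomial_le hσ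
  refine ⟨Real.exp (2 * 2 ^ 2) * K, by positivity, fun T hT R hR ↦ ?_⟩
  have hζ := continuous_riemannZeta_vertical (x := 2) (by norm_num)
  have hDc := continuous_divisorPolynomial_vertical (Finset.Icc 1 ⌊T⌋₊) two_pos
  calc _ ≤ ∫ t in (-R)..R, Real.exp (2 * 2 ^ 2) * (‖riemannZeta ((2 : ℝ) + t * I) ^ 2 -
        divisorPolynomial (Finset.Icc 1 ⌊T⌋₊) ((2 : ℝ) + t * I)‖ ^ 2 *
        Real.exp (-2 * t ^ 2 / T ^ 2)) := by
        refine intervalIntegral.integral_mono (by linarith) ?_ ?_ fun t ↦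
          norm_smoothedZetaSqError_sq_le hT _ two_pos (by norm_num) le_rfl t
        · exact (((continuous_smoothedZetaSqError_vertical T _ two_pos).norm).pow
            2).intervalIntegrable _ _
        · exact Continuous.intervalIntegrable (by fun_prop) _ _
    _ ≤ _ := by
        rw [intervalIntegral.integral_const_mul, mul_assoc]
        gcongr
        exact h T hT R hR

/-- The fourth moment of `ζ` on `[-R, R]` at abscissa `σ`, with a Gaussian weight of width `T`. -/
noncomputable def gaussianFourthMoment (σ T R : ℝ) : ℝ :=
  ∫ t in (-R)..R, ‖riemannZeta (σ + t * I)‖ ^ 4 * Real.exp (-2 * t ^ 2 / T ^ 2)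

lemma mul_norm_add_one_le_norm_sub_one {x : ℝ} (hx : x ∈ Set.Ioo (0 : ℝ) 1) (t : ℝ) :
    (1 - x) / (1 + x) * ‖(x + t * I + 1 : ℂ)‖ ≤ ‖(x + t * I - 1 : ℂ)‖ := by
  obtain ⟨h0, h1⟩ := hx
  have hc : 0 ≤ (1 - x) / (1 + x) := div_nonneg (by linarith) (by linarith)
  have hc1 : (1 - x) / (1 + x) ≤ 1 := (div_le_one (by linarith)).mpr (by linarith)
  have hcx : (1 - x) / (1 + x) * (1 + x) = 1 - x := div_mul_cancel₀ _ (by linarith)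
  refine (pow_le_pow_iff_left₀ (by positivity) (norm_nonneg _) two_ne_zero).mp ?_
  have e1 : ‖(x + t * I + 1 : ℂ)‖ ^ 2 = (1 + x) ^ 2 + t ^ 2 := by
    rw [← normSq_eq_norm_sq, normSq_apply]
    simp
    ring
  have e2 : ‖(x + t * I - 1 : ℂ)‖ ^ 2 = (1 - x) ^ 2 + t ^ 2 := by
    rw [← normSq_eq_norm_sq, normSq_apply]
    simp
    ring
  rw [mul_pow, e1, e2, mul_add, ← mul_pow, hcx]
  nlinarith [mul_le_mul_of_nonneg_right (pow_le_one₀ (n := 2) hc hc1) (sq_nonneg t)]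

lemma exists_gaussianFourthMoment_le_interp {σ : ℝ} (hσ : σ ∈ Set.Ioo (1 / 2 : ℝ) 1) :
    ∃ C : ℝ, 0 < C ∧ ∀ T X : ℝ, 1 ≤ T → 0 ≤ X →
      (∀ R : ℝ, 0 ≤ R → gaussianFourthMoment σ (2 * T) R ≤ X) →
      ∀ R : ℝ, 0 ≤ R → gaussianFourthMoment σ T R ≤
        C * (T + T ^ ((2 * σ - 1) / (1 + σ)) * (X + T) ^ (1 - (2 * σ - 1) / (1 + σ))) := by
  obtain ⟨CA, hCA, hA⟩ := exists_meanSquare_smoothedZetaSqError_left_le hσ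
  obtain ⟨CB, hCB, hB⟩ := exists_meanSquare_smoothedZetaSqError_right_le hσ
  obtain ⟨K, hK, hD⟩ := exists_meanSquare_divisorPolynomial_Icc_le hσ.1
  obtain ⟨hσ0, hσ1⟩ := hσ
  have hx0 : 0 < σ := by linarith
  obtain ⟨θ, hθ⟩ : ∃ θ, θ = (2 * σ - 1) / (1 + σ) := ⟨_, rfl⟩
  have hθmul : θ * (1 + σ) = 2 * σ - 1 := by rw [hθ, div_mul_cancel₀ _ (by linarith)]
  rw [← hθ]
  obtain ⟨c, hc⟩ : ∃ c, c = (1 - σ) / (1 + σ) := ⟨_, rfl⟩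
  have hc0 : 0 < c := hc ▸ div_pos (by linarith) (by linarith)
  refine ⟨2 * ((c ^ 4)⁻¹ * (CA ^ (1 - θ) * CB ^ θ) + K), by positivity,
    fun T X hT hX hM R hR ↦ ?_⟩
  have hT0 : 0 < T := by linarith
  obtain ⟨S, hS⟩ : ∃ S, S = Finset.Icc 1 ⌊T⌋₊ := ⟨_, rfl⟩
  have hζ := continuous_riemannZeta_vertical hσ1.ne
  have hDc := continuous_divisorPolynomial_vertical S hx0
  have hGc := continuous_smoothedZetaSqError_vertical T S hx0
  have hG : ∫ t in (-R)..R, ‖smoothedZetaSqError T S (σ + t * I)‖ ^ 2 ≤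
      CA ^ (1 - θ) * CB ^ θ * (T ^ θ * (X + T) ^ (1 - θ)) := by
    have h := meanSquare_le_interp (f := smoothedZetaSqError T S) (l := 1 - σ) (u := 2) (σ := σ)
      (by linarith) (by linarith) ⟨by linarith, by linarith⟩
      (differentiableOn_smoothedZetaSqError T S)
      (exists_norm_smoothedZetaSqError_le hT S (by linarith))
      (fun R hR ↦ hS ▸ hA T X hT hX hM R hR) (fun R hR ↦ hS ▸ hB T hT R hR) hR
    refine h.trans_eq ?_
    have e : (σ - (1 - σ)) / (2 - (1 - σ)) = θ := by
      rw [hθ]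
      congr 1 <;> ring
    rw [e, Real.mul_rpow hCA.le (by positivity), Real.mul_rpow (by positivity) (by positivity),
      Real.mul_rpow hCB.le (by positivity), ← Real.rpow_mul hT0.le, ← Real.rpow_mul hT0.le]
    have e2 : T ^ θ = T ^ ((4 * σ - 2) * (1 - θ)) * T ^ ((2 * σ - 3) * θ) := by
      rw [← Real.rpow_add hT0]
      congr 1
      linarith
    rw [e2]
    ring
  have hpt (t : ℝ) : ‖riemannZeta (σ + t * I)‖ ^ 4 * Real.exp (-2 * t ^ 2 / T ^ 2) ≤
      2 * ((c ^ 4)⁻¹ * ‖smoothedZetaSqError T S (σ + t * I)‖ ^ 2 +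
        ‖divisorPolynomial S (σ + t * I)‖ ^ 2 * Real.exp (-2 * t ^ 2 / T ^ 2)) := by
    have h1 := mul_le_norm_smoothedZetaSqError_sq T S (t := t) hx0
      (fun h ↦ hσ1.ne (by simpa using congrArg re h)) hc0.le
      (hc ▸ mul_norm_add_one_le_norm_sub_one ⟨hx0, hσ1⟩ t)
    rw [← le_inv_mul_iff₀ (by positivity)] at h1
    have h2 := mul_le_mul_of_nonneg_right (norm_pow_four_le (riemannZeta (σ + t * I))
      (divisorPolynomial S (σ + t * I))) (Real.exp_nonneg (-2 * t ^ 2 / T ^ 2))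
    linarith
  calc _ ≤ ∫ t in (-R)..R, 2 * ((c ^ 4)⁻¹ * ‖smoothedZetaSqError T S (σ + t * I)‖ ^ 2 +
        ‖divisorPolynomial S (σ + t * I)‖ ^ 2 * Real.exp (-2 * t ^ 2 / T ^ 2)) := by
        refine intervalIntegral.integral_mono (by linarith) ?_ ?_ hpt
        · exact Continuous.intervalIntegrable (by fun_prop) _ _
        · exact Continuous.intervalIntegrable (by fun_prop) _ _
    _ = 2 * ((c ^ 4)⁻¹ * (∫ t in (-R)..R, ‖smoothedZetaSqError T S (σ + t * I)‖ ^ 2) +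
        ∫ t in (-R)..R, ‖divisorPolynomial S (σ + t * I)‖ ^ 2 * Real.exp (-2 * t ^ 2 / T ^ 2)) := by
        rw [intervalIntegral.integral_const_mul, intervalIntegral.integral_add,
          intervalIntegral.integral_const_mul]
        · exact Continuous.intervalIntegrable (by fun_prop) _ _
        · exact Continuous.intervalIntegrable (by fun_prop) _ _
    _ ≤ 2 * ((c ^ 4)⁻¹ * (CA ^ (1 - θ) * CB ^ θ * (T ^ θ * (X + T) ^ (1 - θ))) +
          K * T ^ (1 + 2 * (σ - σ))) := by
        gcongr
        exact hS ▸ hD T hT σ le_rfl R hR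
    _ ≤ _ := by
        rw [sub_self, mul_zero, add_zero, Real.rpow_one]
        obtain ⟨Y, hY⟩ : ∃ Y, Y = T ^ θ * (X + T) ^ (1 - θ) := ⟨_, rfl⟩
        obtain ⟨L, hL⟩ : ∃ L, L = (c ^ 4)⁻¹ * (CA ^ (1 - θ) * CB ^ θ) := ⟨_, rfl⟩
        have hY0 : 0 ≤ Y := hY ▸ by positivity
        have hL0 : 0 ≤ L := hL ▸ by positivity
        rw [← mul_assoc (c ^ 4)⁻¹, ← hY, ← hL]
        nlinarith [mul_nonneg hK.le hY0, mul_nonneg hL0 hT0.le]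

lemma norm_riemannZeta_le_of_lt_one {σ : ℝ} (hσ : σ ∈ Set.Ioo (0 : ℝ) 1) (t : ℝ) :
    ‖riemannZeta (σ + t * I)‖ ≤ (1 / (1 - σ) + 1 / σ) * (1 + |t|) := by
  obtain ⟨h0, h1⟩ := hσ
  have hne : (σ + t * I : ℂ) ≠ 1 := fun h ↦ h1.ne (by simpa using congrArg re h)
  have hre : (σ + t * I : ℂ).re = σ := by simp
  have h := norm_riemannZeta₁_le (s := σ + t * I) (by rw [hre]; exact h0)
  have hs : ‖(σ + t * I : ℂ)‖ ≤ 1 + |t| := by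
    refine (norm_add_le _ _).trans ?_
    simp only [norm_mul, norm_real, norm_I, mul_one, Real.norm_eq_abs, abs_of_pos h0]
    linarith
  have hd : 1 - σ ≤ ‖(σ + t * I - 1 : ℂ)‖ := by
    have := abs_re_le_norm (σ + t * I - 1 : ℂ)
    rw [sub_re, hre, one_re, abs_of_neg (by linarith)] at this
    linarith
  rw [hre] at h
  rw [riemannZeta_eq_inv_sub_mul hne, norm_mul, norm_inv]
  have hd0 : 0 < 1 - σ := by linarith
  have hn0 : 0 < ‖(σ + t * I - 1 : ℂ)‖ := hd0.trans_le hd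
  calc _ ≤ ‖(σ + t * I - 1 : ℂ)‖⁻¹ * (‖(σ + t * I : ℂ)‖ * (1 + ‖(σ + t * I - 1 : ℂ)‖ / σ)) := by
        gcongr
    _ = (1 / ‖(σ + t * I - 1 : ℂ)‖ + 1 / σ) * ‖(σ + t * I : ℂ)‖ := by
        field_simp
    _ ≤ _ := by gcongr

lemma one_add_abs_pow_four_mul_gaussian_le {T : ℝ} (hT : 1 ≤ T) (t : ℝ) :
    (1 + |t|) ^ 4 * Real.exp (-2 * t ^ 2 / T ^ 2) ≤
      16 * T ^ 4 * Real.exp (-(T ^ 2)⁻¹ * t ^ 2) := by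
  have hT0 : 0 < T := by linarith
  obtain ⟨u, hu⟩ : ∃ u, u = |t| / T := ⟨_, rfl⟩
  have hu0 : 0 ≤ u := hu ▸ by positivity
  have e1 : u ^ 2 = t ^ 2 / T ^ 2 := by rw [hu, div_pow, sq_abs]
  have h2 : 1 + |t| ≤ T * (1 + u) := by
    rw [mul_add, hu, mul_div_cancel₀ _ hT0.ne']
    linarith
  have h3 : (1 + u) ^ 2 ≤ 4 * Real.exp (u ^ 2 / 2) := by
    nlinarith [Real.add_one_le_exp (u ^ 2 / 2), sq_nonneg (u - 1)]
  have h4 : (1 + u) ^ 4 ≤ 16 * Real.exp (u ^ 2) := by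
    have := pow_le_pow_left₀ (by positivity) h3 2
    rw [mul_pow, ← Real.exp_nat_mul] at this
    calc _ = ((1 + u) ^ 2) ^ 2 := by ring
      _ ≤ _ := this
      _ = _ := by
        congr 1
        · norm_num
        · congr 1
          push_cast
          ring
  have e2 : -2 * t ^ 2 / T ^ 2 = -2 * u ^ 2 := by rw [mul_div_assoc, e1]
  have e3 : -(T ^ 2)⁻¹ * t ^ 2 = u ^ 2 + -2 * u ^ 2 := by
    rw [e1]
    field_simp
    ring
  rw [e2, e3, Real.exp_add]
  calc _ ≤ (T * (1 + u)) ^ 4 * Real.exp (-2 * u ^ 2) := by gcongr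
    _ = T ^ 4 * (1 + u) ^ 4 * Real.exp (-2 * u ^ 2) := by rw [mul_pow]
    _ ≤ T ^ 4 * (16 * Real.exp (u ^ 2)) * Real.exp (-2 * u ^ 2) := by gcongr
    _ = _ := by ring

lemma intervalIntegral_gaussian_le {T : ℝ} (hT : 0 < T) {R : ℝ} (hR : 0 ≤ R) :
    ∫ t in (-R)..R, Real.exp (-(T ^ 2)⁻¹ * t ^ 2) ≤ 4 * T := by
  rw [intervalIntegral.integral_of_le (by linarith)]
  refine (MeasureTheory.setIntegral_le_integral (integrable_exp_neg_mul_sq (by positivity))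
    (Filter.Eventually.of_forall fun t ↦ (Real.exp_nonneg _))).trans ?_
  rw [integral_gaussian, div_inv_eq_mul, Real.sqrt_mul Real.pi_pos.le, Real.sqrt_sq hT.le]
  gcongr
  rw [Real.sqrt_le_left (by norm_num)]
  linarith [Real.pi_le_four]

lemma exists_gaussianFourthMoment_le_pow {σ : ℝ} (hσ : σ ∈ Set.Ioo (0 : ℝ) 1) :
    ∃ K : ℝ, 0 < K ∧ ∀ T R : ℝ, 1 ≤ T → 0 ≤ R → gaussianFourthMoment σ T R ≤ K * T ^ 5 := by
  obtain ⟨L, hL⟩ : ∃ L, L = 1 / (1 - σ) + 1 / σ := ⟨_, rfl⟩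
  have hL0 : 0 < L := by
    have := hσ.1
    have := sub_pos.mpr hσ.2
    rw [hL]
    positivity
  refine ⟨64 * L ^ 4, by positivity, fun T R hT hR ↦ ?_⟩
  have hζ := continuous_riemannZeta_vertical hσ.2.ne
  calc _ ≤ ∫ t in (-R)..R, 16 * L ^ 4 * T ^ 4 * Real.exp (-(T ^ 2)⁻¹ * t ^ 2) := by
        refine intervalIntegral.integral_mono (by linarith) ?_ ?_ fun t ↦ ?_
        · exact Continuous.intervalIntegrable (by fun_prop) _ _
        · exact Continuous.intervalIntegrable (by fun_prop) _ _
        · have h1 := pow_le_pow_left₀ (norm_nonneg _) (norm_riemannZeta_le_of_lt_one hσ t) 4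
          rw [← hL, mul_pow] at h1
          have h2 := mul_le_mul_of_nonneg_left (one_add_abs_pow_four_mul_gaussian_le hT t)
            (pow_nonneg hL0.le 4)
          have h3 := mul_le_mul_of_nonneg_right h1 (Real.exp_nonneg (-2 * t ^ 2 / T ^ 2))
          dsimp only
          linarith
    _ ≤ 16 * L ^ 4 * T ^ 4 * (4 * T) := by
        rw [intervalIntegral.integral_const_mul]
        gcongr
        exact intervalIntegral_gaussian_le (by linarith) hR
    _ = _ := by ring

lemma exists_rpow_mul_rpow_le {θ ε : ℝ} (hθ : θ ∈ Set.Ioo (0 : ℝ) 1) (hε : 0 < ε) :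
    ∃ c : ℝ, 0 < c ∧ ∀ x y : ℝ, 0 ≤ x → 0 ≤ y → x ^ θ * y ^ (1 - θ) ≤ c * x + ε * y := by
  obtain ⟨h0, h1⟩ := hθ
  refine ⟨ε ^ (-(1 - θ) / θ), by positivity, fun x y hx hy ↦ ?_⟩
  have hc : 0 < ε ^ (-(1 - θ) / θ) := by positivity
  have h := Real.geom_mean_le_arith_mean2_weighted h0.le (sub_nonneg.mpr h1.le)
    (mul_nonneg hc.le hx) (mul_nonneg hε.le hy) (by ring)
  have e : (ε ^ (-(1 - θ) / θ)) ^ θ * ε ^ (1 - θ) = 1 := by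
    rw [← Real.rpow_mul hε.le, div_mul_cancel₀ _ h0.ne', ← Real.rpow_add hε, neg_add_cancel,
      Real.rpow_zero]
  rw [Real.mul_rpow hc.le hx, Real.mul_rpow hε.le hy] at h
  calc x ^ θ * y ^ (1 - θ) = (ε ^ (-(1 - θ) / θ)) ^ θ * x ^ θ * (ε ^ (1 - θ) * y ^ (1 - θ)) := by
        linear_combination -(x ^ θ * y ^ (1 - θ)) * e
    _ ≤ _ := h
    _ ≤ _ := by
        have := mul_nonneg hc.le hx
        have := mul_nonneg hε.le hy
        exact add_le_add (mul_le_of_le_one_left ‹_› h1.le)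
          (mul_le_of_le_one_left ‹_› (by linarith))

lemma exists_gaussianFourthMoment_le {σ : ℝ} (hσ : σ ∈ Set.Ioo (1 / 2 : ℝ) 1) :
    ∃ K : ℝ, 0 < K ∧ ∀ T R : ℝ, 1 ≤ T → 0 ≤ R → gaussianFourthMoment σ T R ≤ K * T := by
  obtain ⟨C, hC, h⟩ := exists_gaussianFourthMoment_le_interp hσ
  obtain ⟨K, hK, hpow⟩ := exists_gaussianFourthMoment_le_pow
    (σ := σ) ⟨by linarith [hσ.1], hσ.2⟩
  obtain ⟨c, hc, hyoung⟩ := exists_rpow_mul_rpow_le (θ := (2 * σ - 1) / (1 + σ))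
    (ε := 1 / (64 * C)) ⟨div_pos (by linarith [hσ.1]) (by linarith [hσ.1]),
      (div_lt_one (by linarith [hσ.1])).mpr (by linarith [hσ.2])⟩ (by positivity)
  obtain ⟨D, hD⟩ : ∃ D, D = C + C * c + 1 / 64 := ⟨_, rfl⟩
  have hD0 : 0 < D := hD ▸ by positivity
  have hrec (T X : ℝ) (hT : 1 ≤ T) (hX : 0 ≤ X)
      (hM : ∀ R : ℝ, 0 ≤ R → gaussianFourthMoment σ (2 * T) R ≤ X) (R : ℝ) (hR : 0 ≤ R) :
      gaussianFourthMoment σ T R ≤ D * T + X / 64 := by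
    refine (h T X hT hX hM R hR).trans ?_
    have h1 := mul_le_mul_of_nonneg_left (hyoung T (X + T) (by linarith) (by linarith)) hC.le
    have e : C * (1 / (64 * C) * (X + T)) = (X + T) / 64 := by field_simp
    rw [mul_add C (c * T), e] at h1
    rw [mul_add, hD]
    linarith
  have hind (k : ℕ) : ∀ T R : ℝ, 1 ≤ T → 0 ≤ R →
      gaussianFourthMoment σ T R ≤ 2 * D * T + K * T ^ 5 * (1 / 2) ^ k := by
    induction k with
    | zero =>
      intro T R hT hR
      have := hpow T R hT hR
      have := mul_pos hD0 (zero_lt_one.trans_le hT)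
      linarith
    | succ k ih =>
      intro T R hT hR
      have hT0 : 0 < T := by linarith
      refine (hrec T (2 * D * (2 * T) + K * (2 * T) ^ 5 * (1 / 2) ^ k) hT (by positivity)
        (fun R hR ↦ ih (2 * T) R (by linarith) hR) R hR).trans ?_
      have := mul_pos hD0 hT0
      rw [pow_succ (1 / 2 : ℝ), mul_pow 2 T]
      linarith
  refine ⟨2 * D, by positivity, fun T R hT hR ↦ ?_⟩
  refine ge_of_tendsto' (x := Filter.atTop)
    (f := fun k : ℕ ↦ 2 * D * T + K * T ^ 5 * (1 / 2) ^ k) ?_ fun k ↦ hind k T R hT hR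
  have := ((tendsto_pow_atTop_nhds_zero_of_lt_one (r := (1 / 2 : ℝ)) (by norm_num)
    (by norm_num)).const_mul (K * T ^ 5)).const_add (2 * D * T)
  simpa using this

lemma exists_norm_riemannZeta_vertical_le {x : ℝ} (hx : 1 < x) :
    ∃ Z : ℝ, 0 < Z ∧ ∀ t : ℝ, ‖riemannZeta (x + t * I)‖ ≤ Z := by
  have hs : Summable fun n : ℕ ↦ 1 / (n : ℝ) ^ x := Real.summable_one_div_nat_rpow.mpr hx
  have h0 : 0 ≤ ∑' n : ℕ, 1 / (n : ℝ) ^ x := tsum_nonneg fun n ↦ by positivity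
  refine ⟨1 + ∑' n : ℕ, 1 / (n : ℝ) ^ x, by linarith, fun t ↦ ?_⟩
  have hn (n : ℕ) : ‖1 / (n : ℂ) ^ (x + t * I : ℂ)‖ = 1 / (n : ℝ) ^ x := by
    rw [norm_div, norm_one, norm_natCast_cpow_of_re_ne_zero n (by simpa using by linarith)]
    simp
  rw [zeta_eq_tsum_one_div_nat_cpow (by simpa using hx)]
  refine (norm_tsum_le_tsum_norm (by simpa only [hn] using hs)).trans ?_
  simp only [hn]
  linarith

lemma norm_add_one_le_five_mul_norm_sub_one (x : ℝ) {t : ℝ} (ht : 1 / 2 ≤ t) :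
    1 / 5 * ‖(x + t * I + 1 : ℂ)‖ ≤ ‖(x + t * I - 1 : ℂ)‖ := by
  refine (pow_le_pow_iff_left₀ (by positivity) (norm_nonneg _) two_ne_zero).mp ?_
  rw [mul_pow, ← normSq_eq_norm_sq, normSq_apply, ← normSq_eq_norm_sq, normSq_apply]
  simp
  nlinarith [sq_nonneg (12 * x - 13)]

lemma intervalIntegrable_norm_riemannZeta_pow_four (x : ℝ) {a b : ℝ} (ha : 1 / 2 ≤ a)
    (hab : a ≤ b) :
    IntervalIntegrable (fun t : ℝ ↦ ‖riemannZeta (x + t * I)‖ ^ 4) MeasureTheory.volume a b := by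
  refine ContinuousOn.intervalIntegrable fun t ht ↦ ContinuousAt.continuousWithinAt ?_
  rw [Set.uIcc_of_le hab] at ht
  have hne : (x + t * I : ℂ) ≠ 1 := by
    intro h
    have := congrArg im h
    simp at this
    linarith [ht.1]
  have : ContinuousAt (fun t : ℝ ↦ riemannZeta (x + t * I)) t :=
    ContinuousAt.comp (f := fun t : ℝ ↦ (x + t * I : ℂ))
      (differentiableAt_riemannZeta hne).continuousAt (by fun_prop)
  exact this.norm.pow 4

lemma exists_fourthMoment_zeta_strip_le {σ u : ℝ} (hσ : σ ∈ Set.Ioo (1 / 2 : ℝ) 1) (hu : 1 < u) :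
    ∃ C : ℝ, 0 < C ∧ ∀ x ∈ Set.Icc σ u, ∀ U : ℝ, 1 ≤ U →
      ∫ t in (1 / 2)..U, ‖riemannZeta (x + t * I)‖ ^ 4 ≤ C * U := by
  obtain ⟨K, hK, hM⟩ := exists_gaussianFourthMoment_le hσ
  obtain ⟨Z, hZ, hZb⟩ := exists_norm_riemannZeta_vertical_le hu
  obtain ⟨hσ0, hσ1⟩ := hσ
  have hx0 : 0 < σ := by linarith
  have hu0 : 0 < u := by linarith
  obtain ⟨D, hD⟩ : ∃ D, D = Real.exp (2 * u ^ 2) * (K + 4 * Z ^ 4) := ⟨_, rfl⟩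
  have hD0 : 0 < D := hD ▸ by positivity
  refine ⟨625 * Real.exp 2 * D, by positivity, fun x hx U hU ↦ ?_⟩
  have hU0 : 0 < U := by linarith
  have hxpos : 0 < x := hx0.trans_le hx.1
  have hmean (y : ℝ) (hy0 : 0 < y) (hy1 : y ≠ 1) (hyu : y ≤ u) (R : ℝ) (hR : 0 ≤ R) :
      ∫ t in (-R)..R, ‖smoothedZetaSqError U ∅ (y + t * I)‖ ^ 2 ≤
        Real.exp (2 * u ^ 2) * gaussianFourthMoment y U R := by
    have hζ := continuous_riemannZeta_vertical hy1
    rw [gaussianFourthMoment, ← intervalIntegral.integral_const_mul]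
    refine intervalIntegral.integral_mono (by linarith) ?_ ?_ fun t ↦ ?_
    · exact (((continuous_smoothedZetaSqError_vertical U ∅ hy0).norm).pow 2).intervalIntegrable _ _
    · exact Continuous.intervalIntegrable (by fun_prop) _ _
    · have := norm_smoothedZetaSqError_sq_le hU ∅ hy0 hy1 hyu t
      simpa [divisorPolynomial, ← pow_mul] using this
  have hleft (R : ℝ) (hR : 0 ≤ R) :
      ∫ t in (-R)..R, ‖smoothedZetaSqError U ∅ (σ + t * I)‖ ^ 2 ≤ D * U := by
    refine (hmean σ hx0 hσ1.ne (by linarith) R hR).trans ?_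
    rw [hD, mul_assoc]
    gcongr
    refine (hM U R hU hR).trans ?_
    gcongr
    linarith [pow_pos hZ 4]
  have hright (R : ℝ) (hR : 0 ≤ R) :
      ∫ t in (-R)..R, ‖smoothedZetaSqError U ∅ (u + t * I)‖ ^ 2 ≤ D * U := by
    refine (hmean u hu0 hu.ne' le_rfl R hR).trans ?_
    rw [hD, mul_assoc]
    gcongr
    have hζ := continuous_riemannZeta_vertical hu.ne'
    calc _ ≤ ∫ t in (-R)..R, Z ^ 4 * Real.exp (-(U ^ 2)⁻¹ * t ^ 2) := by
          refine intervalIntegral.integral_mono (by linarith) ?_ ?_ fun t ↦ ?_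
          · exact Continuous.intervalIntegrable (by fun_prop) _ _
          · exact Continuous.intervalIntegrable (by fun_prop) _ _
          · dsimp only
            gcongr
            · exact hZb t
            · rw [neg_mul, neg_mul, neg_div, neg_le_neg_iff, mul_div_assoc, inv_mul_eq_div]
              have : 0 ≤ t ^ 2 / U ^ 2 := by positivity
              linarith
      _ ≤ Z ^ 4 * (4 * U) := by
          rw [intervalIntegral.integral_const_mul]
          gcongr
          exact intervalIntegral_gaussian_le hU0 hR
      _ ≤ _ := by
          have := mul_pos hK hU0
          linarith
  have hmid : ∫ t in (-U)..U, ‖smoothedZetaSqError U ∅ (x + t * I)‖ ^ 2 ≤ D * U := by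
    have h := meanSquare_le_interp (f := smoothedZetaSqError U ∅) hx0 (by linarith) hx
      (differentiableOn_smoothedZetaSqError U ∅)
      (exists_norm_smoothedZetaSqError_le hU ∅ hx0) hleft hright hU0.le
    rwa [← Real.rpow_add (by positivity), sub_add_cancel, Real.rpow_one] at h
  have hGc := continuous_smoothedZetaSqError_vertical U ∅ hxpos
  have hne (t : ℝ) (ht : 1 / 2 ≤ t) : (x + t * I : ℂ) ≠ 1 := by
    intro h
    have := congrArg im h
    simp at this
    linarith
  calc _ ≤ ∫ t in (1 / 2)..U, 625 * Real.exp 2 * ‖smoothedZetaSqError U ∅ (x + t * I)‖ ^ 2 := by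
        refine intervalIntegral.integral_mono_on (by linarith) ?_ ?_ fun t ht ↦ ?_
        · exact intervalIntegrable_norm_riemannZeta_pow_four x le_rfl (by linarith)
        · exact Continuous.intervalIntegrable (by fun_prop) _ _
        · have h := mul_le_norm_smoothedZetaSqError_sq U ∅ hxpos (hne t ht.1) (by norm_num)
            (norm_add_one_le_five_mul_norm_sub_one x ht.1)
          have he : Real.exp (-2) ≤ Real.exp (-2 * t ^ 2 / U ^ 2) := by
            rw [Real.exp_le_exp, mul_div_assoc, ← div_pow]
            have h1 : t / U ≤ 1 := (div_le_one hU0).mpr ht.2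
            have h0 : 0 ≤ t / U := div_nonneg (by linarith [ht.1]) hU0.le
            nlinarith
          simp only [divisorPolynomial, Finset.sum_empty, sub_zero, norm_pow, ← pow_mul] at h
          have h2 := mul_le_mul_of_nonneg_left he
            (pow_nonneg (norm_nonneg (riemannZeta (x + t * I))) 4)
          have h3 : Real.exp 2 * Real.exp (-2) = 1 := by rw [← Real.exp_add]; simp
          calc _ = Real.exp 2 * (‖riemannZeta (x + t * I)‖ ^ 4 * Real.exp (-2)) := by
                linear_combination -(‖riemannZeta (x + t * I)‖ ^ 4) * h3
            _ ≤ Real.exp 2 * (625 * ‖smoothedZetaSqError U ∅ (x + t * I)‖ ^ 2) := by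
                refine mul_le_mul_of_nonneg_left ?_ (Real.exp_nonneg _)
                norm_num only at h h2 ⊢
                linarith
            _ = _ := by ring
    _ = 625 * Real.exp 2 * ∫ t in (1 / 2)..U, ‖smoothedZetaSqError U ∅ (x + t * I)‖ ^ 2 :=
        intervalIntegral.integral_const_mul _ _
    _ ≤ 625 * Real.exp 2 * ∫ t in (-U)..U, ‖smoothedZetaSqError U ∅ (x + t * I)‖ ^ 2 := by
        gcongr
        refine intervalIntegral.integral_mono_interval (by linarith) (by linarith) le_rfl
          (Filter.Eventually.of_forall fun t ↦ by positivity) ?_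
        exact Continuous.intervalIntegrable (by fun_prop) _ _
    _ ≤ 625 * Real.exp 2 * (D * U) := by gcongr
    _ = _ := by ring

lemma intervalIntegral_pow_four_le {a b : ℝ} (hab : a ≤ b) {g : ℝ → ℝ} (hg : Continuous g) :
    (∫ t in a..b, g t) ^ 4 ≤ (b - a) ^ 3 * ∫ t in a..b, g t ^ 4 := by
  have h1 := sq_intervalIntegral_mul_le hab continuous_const (u := fun _ ↦ (1 : ℝ)) hg
  have h2 := sq_intervalIntegral_mul_le hab continuous_const (u := fun _ ↦ (1 : ℝ))
    (v := fun t ↦ g t ^ 2) (by fun_prop)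
  simp only [one_mul, one_pow, intervalIntegral.integral_const, smul_eq_mul, mul_one,
    ← pow_mul] at h1 h2
  norm_num only at h2
  have hba : 0 ≤ b - a := sub_nonneg.mpr hab
  calc (∫ t in a..b, g t) ^ 4 = ((∫ t in a..b, g t) ^ 2) ^ 2 := by ring
    _ ≤ ((b - a) * ∫ t in a..b, g t ^ 2) ^ 2 := by gcongr
    _ = (b - a) ^ 2 * (∫ t in a..b, g t ^ 2) ^ 2 := mul_pow _ _ _
    _ ≤ (b - a) ^ 2 * ((b - a) * ∫ t in a..b, g t ^ 4) := by gcongr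
    _ = _ := by ring

lemma norm_iteratedDeriv_le_integral_circleMap {f : ℂ → ℂ} {c : ℂ} {r : ℝ} (hr : 0 < r) (n : ℕ)
    (hf : DifferentiableOn ℂ f (Metric.closedBall c r)) :
    ‖iteratedDeriv n f c‖ ≤
      n.factorial / (2 * Real.pi * r ^ n) * ∫ φ in (0)..(2 * Real.pi), ‖f (circleMap c r φ)‖ := by
  have h := hf.circleIntegral_one_div_sub_center_pow_smul hr n
  have h1 : ‖∮ z in C(c, r), (1 / (z - c) ^ (n + 1)) • f z‖ ≤
      (r ^ n)⁻¹ * ∫ φ in (0)..(2 * Real.pi), ‖f (circleMap c r φ)‖ := by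
    rw [circleIntegral, ← intervalIntegral.integral_const_mul]
    refine (intervalIntegral.norm_integral_le_integral_norm Real.two_pi_pos.le).trans_eq ?_
    refine intervalIntegral.integral_congr fun φ _ ↦ ?_
    simp only [deriv_circleMap, circleMap_sub_center, norm_smul, norm_mul, norm_circleMap_zero,
      norm_I, norm_div, norm_one, norm_pow, abs_of_pos hr, mul_one]
    field_simp
    ring
  rw [h, norm_smul] at h1
  simp only [norm_div, norm_mul, norm_I, norm_ofNat, norm_real, Real.norm_eq_abs,
    abs_of_pos Real.pi_pos, Complex.norm_natCast, mul_one] at h1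
  rw [div_mul_eq_mul_div, div_le_iff₀ (by positivity)] at h1
  rw [div_mul_eq_mul_div, le_div_iff₀ (by positivity)]
  calc _ = 2 * Real.pi * ‖iteratedDeriv n f c‖ * r ^ n := by ring
    _ ≤ _ := mul_le_mul_of_nonneg_right h1 (by positivity)
    _ = _ := by field_simp

lemma circleMap_add_mul_I (τ t r φ : ℝ) :
    circleMap (τ + t * I) r φ =
      (τ + r * Real.cos φ : ℝ) + (t + r * Real.sin φ : ℝ) * I := by
  rw [circleMap, exp_mul_I]
  push_cast
  ring

lemma circleMap_ne_one (τ : ℝ) {r t : ℝ} (hr0 : 0 ≤ r) (hr : r ≤ 1 / 2) (ht : 1 ≤ t) (φ : ℝ) :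
    circleMap (τ + t * I) r φ ≠ 1 := by
  intro h
  rw [circleMap_add_mul_I] at h
  have him := congrArg im h
  simp only [add_im, ofReal_im, mul_im, ofReal_re, I_im, mul_one, I_re, mul_zero, add_zero,
    zero_add, one_im] at him
  nlinarith [Real.neg_one_le_sin φ]

lemma integrable_norm_riemannZeta_circleMap_pow_four (τ : ℝ) {r U : ℝ} (hr0 : 0 ≤ r)
    (hr : r ≤ 1 / 2) (hU : 1 ≤ U) :
    MeasureTheory.IntegrableOn
      (Function.uncurry fun t φ : ℝ ↦ ‖riemannZeta (circleMap (τ + t * I) r φ)‖ ^ 4)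
      (Set.uIoc 1 U ×ˢ Set.uIoc 0 (2 * Real.pi)) := by
  rw [Set.uIoc_of_le hU, Set.uIoc_of_le Real.two_pi_pos.le]
  refine MeasureTheory.IntegrableOn.mono_set (ContinuousOn.integrableOn_compact
    (isCompact_Icc.prod isCompact_Icc) fun p hp ↦ ContinuousAt.continuousWithinAt ?_)
    (Set.prod_mono Set.Ioc_subset_Icc_self Set.Ioc_subset_Icc_self)
  have hne := circleMap_ne_one τ hr0 hr hp.1.1 p.2
  have : ContinuousAt (fun q : ℝ × ℝ ↦ riemannZeta (circleMap (τ + q.1 * I) r q.2)) p :=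
    ContinuousAt.comp (f := fun q : ℝ × ℝ ↦ circleMap (τ + q.1 * I) r q.2)
      (differentiableAt_riemannZeta hne).continuousAt (by unfold circleMap; fun_prop)
  exact this.norm.pow 4

lemma exists_integral_circleMap_le {σ τ r u : ℝ} (hσ : σ ∈ Set.Ioo (1 / 2 : ℝ) 1) (hu : 1 < u)
    (hr0 : 0 ≤ r) (hr : r ≤ 1 / 2) (hl : σ ≤ τ - r) (hru : τ + r ≤ u) :
    ∃ C : ℝ, 0 < C ∧ ∀ U : ℝ, 1 ≤ U →
      ∫ t in (1 : ℝ)..U, ∫ φ in (0)..(2 * Real.pi),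
        ‖riemannZeta (circleMap (τ + t * I) r φ)‖ ^ 4 ≤ C * U := by
  obtain ⟨C, hC, h⟩ := exists_fourthMoment_zeta_strip_le hσ hu
  refine ⟨2 * Real.pi * (C * 2), by positivity, fun U hU ↦ ?_⟩
  have hint := integrable_norm_riemannZeta_circleMap_pow_four τ hr0 hr hU
  rw [MeasureTheory.intervalIntegral_intervalIntegral_swap hint]
  have hbound (φ : ℝ) : ∫ t in (1 : ℝ)..U, ‖riemannZeta (circleMap (τ + t * I) r φ)‖ ^ 4 ≤
      C * (2 * U) := by
    have hc := mul_le_mul_of_nonneg_left (Real.cos_le_one φ) hr0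
    have hc' := mul_le_mul_of_nonneg_left (Real.neg_one_le_cos φ) hr0
    have hs := mul_le_mul_of_nonneg_left (Real.sin_le_one φ) hr0
    have hs' := mul_le_mul_of_nonneg_left (Real.neg_one_le_sin φ) hr0
    simp only [circleMap_add_mul_I]
    rw [intervalIntegral.integral_comp_add_right
      (fun t : ℝ ↦ ‖riemannZeta ((τ + r * Real.cos φ : ℝ) + t * I)‖ ^ 4)]
    refine le_trans (intervalIntegral.integral_mono_interval (c := 1 / 2) (d := 2 * U)
      (by linarith) (by linarith) (by linarith)
      (Filter.Eventually.of_forall fun t ↦ by positivity) ?_)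
      (h _ ⟨by linarith, by linarith⟩ (2 * U) (by linarith))
    exact intervalIntegrable_norm_riemannZeta_pow_four _ le_rfl (by linarith)
  calc _ ≤ ‖∫ φ in (0)..(2 * Real.pi), ∫ t in (1 : ℝ)..U,
        ‖riemannZeta (circleMap (τ + t * I) r φ)‖ ^ 4‖ := Real.le_norm_self _
    _ ≤ C * (2 * U) * |2 * Real.pi - 0| := by
        refine intervalIntegral.norm_integral_le_of_norm_le_const fun φ _ ↦ ?_
        rw [Real.norm_of_nonneg (intervalIntegral.integral_nonneg hU fun t _ ↦ by positivity)]
        exact hbound φ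
    _ = _ := by
        rw [sub_zero, abs_of_pos Real.two_pi_pos]
        ring

theorem fourth_moment_zeta_deriv_right_of_half (a : ℕ) (τ : ℝ) (hτ : 1 / 2 < τ) :
    ∃ K : ℝ, 0 < K ∧ ∀ U : ℝ, 1 ≤ U →
      (∫ t in (1 : ℝ)..U, ‖iteratedDeriv a riemannZeta (↑τ + ↑t * Complex.I)‖ ^ 4) ≤ K * U := by
  obtain ⟨σ, hσ0, hσ⟩ := exists_between (lt_min hτ (by norm_num : (1 / 2 : ℝ) < 1))
  obtain ⟨r, hr0, hr⟩ := exists_between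
    (lt_min (sub_pos.mpr (hσ.trans_le (min_le_left _ _))) (by norm_num : (0 : ℝ) < 1 / 2))
  have hrτ : r < τ - σ := hr.trans_le (min_le_left _ _)
  have hr2 : r ≤ 1 / 2 := hr.le.trans (min_le_right _ _)
  obtain ⟨C, hC, h⟩ := exists_integral_circleMap_le (σ := σ) (τ := τ) (r := r) (u := τ + 1)
    ⟨hσ0, hσ.trans_le (min_le_right _ _)⟩ (by linarith) hr0.le hr2 (by linarith) (by linarith)
  obtain ⟨L, hL⟩ : ∃ L, L = (a.factorial / (2 * Real.pi * r ^ a)) ^ 4 * (2 * Real.pi) ^ 3 :=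
    ⟨_, rfl⟩
  have hL0 : 0 < L := hL ▸ by positivity
  refine ⟨L * C, by positivity, fun U hU ↦ ?_⟩
  have hpt (t : ℝ) (ht : 1 ≤ t) : ‖iteratedDeriv a riemannZeta (τ + t * I)‖ ^ 4 ≤
      L * ∫ φ in (0)..(2 * Real.pi), ‖riemannZeta (circleMap (τ + t * I) r φ)‖ ^ 4 := by
    have hdiff : DifferentiableOn ℂ riemannZeta (Metric.closedBall (τ + t * I) r) := by
      intro z hz
      refine (differentiableAt_riemannZeta fun h1 ↦ ?_).differentiableWithinAt
      have h2 := (abs_im_le_norm (z - (τ + t * I))).trans (mem_closedBall_iff_norm.mp hz)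
      rw [h1] at h2
      simp at h2
      linarith [le_abs_self t]
    have hcont : Continuous fun φ ↦ ‖riemannZeta (circleMap (τ + t * I) r φ)‖ :=
      (hdiff.continuousOn.comp_continuous (continuous_circleMap _ _)
        fun φ ↦ circleMap_mem_closedBall _ hr0.le φ).norm
    have h1 := pow_le_pow_left₀ (norm_nonneg _)
      (norm_iteratedDeriv_le_integral_circleMap hr0 a hdiff) 4
    have h2 := intervalIntegral_pow_four_le Real.two_pi_pos.le hcont
    rw [sub_zero] at h2
    rw [mul_pow] at h1
    refine h1.trans ?_
    rw [hL, mul_assoc (_ ^ 4)]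
    exact mul_le_mul_of_nonneg_left h2 (by positivity)
  have hint := integrable_norm_riemannZeta_circleMap_pow_four τ hr0.le hr2 hU
  rw [Set.uIoc_of_le hU, Set.uIoc_of_le Real.two_pi_pos.le, MeasureTheory.IntegrableOn,
    MeasureTheory.Measure.volume_eq_prod, ← MeasureTheory.Measure.prod_restrict] at hint
  have hint2 := hint.integral_prod_left
  calc _ ≤ ∫ t in (1 : ℝ)..U, L * ∫ φ in (0)..(2 * Real.pi),
        ‖riemannZeta (circleMap (τ + t * I) r φ)‖ ^ 4 := by
        simp only [intervalIntegral.integral_of_le hU]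
        refine MeasureTheory.integral_mono_of_nonneg
          (Filter.Eventually.of_forall fun t ↦ by positivity) ?_ ?_
        · simp only [intervalIntegral.integral_of_le Real.two_pi_pos.le]
          exact hint2.const_mul L
        · exact (MeasureTheory.ae_restrict_mem measurableSet_Ioc).mono fun t ht ↦ hpt t ht.1.le
    _ ≤ L * (C * U) := by
        rw [intervalIntegral.integral_const_mul]
        gcongr
        exact h U hU
    _ = _ := by ring
end

section
/- As t → ∞, Σ_{n≤t} α(n)²/n = (6/π²)·(17/20160)·(log t)⁸ + O((log t)⁷). -/
/-- `α(n) = d^{(1,1)}(n) = Σ_{ab=n} (log a)(log b)`. -/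
noncomputable def alphaFn (n : ℕ) : ℝ :=
  ∑ x ∈ n.divisorsAntidiagonal, Real.log x.1 * Real.log x.2

theorem pow_succ_sub_pow_succ_bounds {A B : ℝ} (hB : 0 ≤ B) (hBA : B ≤ A) (k : ℕ) :
    (k + 1) * B ^ k * (A - B) ≤ A ^ (k + 1) - B ^ (k + 1) ∧
      A ^ (k + 1) - B ^ (k + 1) ≤ (k + 1) * A ^ k * (A - B) := by
  have hA : 0 ≤ A := hB.trans hBA
  have hAB : 0 ≤ A - B := sub_nonneg.2 hBA
  induction k with
  | zero => simp
  | succ k ih =>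
    have h1 := mul_le_mul_of_nonneg_left ih.1 hB
    have h2 := mul_le_mul_of_nonneg_left ih.2 hA
    have h3 : B ^ (k + 1) * (A - B) ≤ A ^ (k + 1) * (A - B) := by gcongr
    push_cast
    constructor
    · linear_combination h1 + h3
    · linear_combination h2 + h3

theorem sum_log_div_pow_lower_upper (k : ℕ) {t : ℝ} (N : ℕ) (hN : 1 ≤ N) (hNt : (N : ℝ) ≤ t) :
    (Real.log t ^ (k + 1) - Real.log (t / N) ^ (k + 1)) / (k + 1) + Real.log (t / N) ^ k / N ≤
        ∑ n ∈ Finset.Icc 1 N, Real.log (t / n) ^ k / n ∧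
      ∑ n ∈ Finset.Icc 1 N, Real.log (t / n) ^ k / n ≤
        Real.log t ^ k + (Real.log t ^ (k + 1) - Real.log (t / N) ^ (k + 1)) / (k + 1) := by
  induction N, hN using Nat.le_induction with
  | base =>
    have ht : 1 ≤ t := by simpa using hNt
    simp
  | succ n hn ih =>
    push_cast at hNt
    have hn0 : (1 : ℝ) ≤ n := by exact_mod_cast hn
    obtain ⟨ih1, ih2⟩ := ih (by linarith)
    rw [Finset.sum_Icc_succ_top (by omega)]
    push_cast
    set A := Real.log (t / n) with hA
    set B := Real.log (t / (n + 1)) with hB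
    have hB0 : 0 ≤ B := Real.log_nonneg (by rw [le_div_iff₀ (by positivity)]; linarith)
    have hAB : A - B = Real.log ((n + 1) / n) := by
      rw [hA, hB, Real.log_div (by linarith) (by linarith), Real.log_div (by linarith) (by linarith),
        Real.log_div (by linarith) (by linarith)]
      ring
    have h1 : A - B ≤ 1 / n := by
      rw [hAB]
      refine (Real.log_le_sub_one_of_pos (by positivity)).trans (le_of_eq ?_)
      field_simp
      ring
    have h2 : 1 / (n + 1) ≤ A - B := by
      rw [hAB]
      refine le_trans (le_of_eq ?_) (Real.one_sub_inv_le_log_of_pos (by positivity))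
      field_simp
      ring
    have hBA : B ≤ A := by
      have : (0 : ℝ) ≤ 1 / (n + 1) := by positivity
      linarith
    obtain ⟨h3, h4⟩ := pow_succ_sub_pow_succ_bounds hB0 hBA k
    have hk : (0 : ℝ) < k + 1 := by positivity
    have hA0 : 0 ≤ A := hB0.trans hBA
    have h5 : (A ^ (k + 1) - B ^ (k + 1)) / (k + 1) ≤ A ^ k / n := by
      rw [div_le_iff₀ hk]
      refine h4.trans ?_
      have := mul_le_mul_of_nonneg_left h1 (by positivity : 0 ≤ ((k : ℝ) + 1) * A ^ k)
      refine this.trans (le_of_eq (by ring))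
    have h6 : B ^ k / (n + 1) ≤ (A ^ (k + 1) - B ^ (k + 1)) / (k + 1) := by
      rw [le_div_iff₀ hk]
      refine le_trans ?_ h3
      have := mul_le_mul_of_nonneg_left h2 (by positivity : 0 ≤ ((k : ℝ) + 1) * B ^ k)
      refine le_trans (le_of_eq (by ring)) this
    rw [sub_div] at *
    constructor
    · linarith
    · linarith

theorem exists_sum_log_pow_mul_log_div_pow (a k : ℕ) : ∃ C : ℝ, 0 ≤ C ∧ ∀ t : ℝ, 1 ≤ t →
    |(∑ n ∈ Finset.Icc 1 ⌊t⌋₊, Real.log n ^ a / n * Real.log (t / n) ^ k) -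
      (a.factorial * k.factorial / (a + k + 1).factorial : ℝ) * Real.log t ^ (a + k + 1)| ≤
      C * (1 + Real.log t) ^ (a + k) := by
  induction a generalizing k with
  | zero =>
    refine ⟨1, zero_le_one, fun t ht => ?_⟩
    have hT := Real.log_nonneg ht
    have hN : 1 ≤ ⌊t⌋₊ := Nat.le_floor (by simpa using ht)
    have hN' : (1 : ℝ) ≤ ⌊t⌋₊ := by exact_mod_cast hN
    obtain ⟨h1, h2⟩ := sum_log_div_pow_lower_upper k ⌊t⌋₊ hN (Nat.floor_le (by linarith))
    have h3 : 0 ≤ Real.log (t / ⌊t⌋₊) := Real.log_nonneg (by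
      rw [le_div_iff₀ (by positivity), one_mul]; exact Nat.floor_le (by linarith))
    have h4 : Real.log (t / ⌊t⌋₊) ≤ 1 := by
      refine (Real.log_le_sub_one_of_pos (by positivity)).trans ?_
      rw [sub_le_iff_le_add, div_le_iff₀ (by positivity)]
      linarith [Nat.lt_floor_add_one t]
    have h5 : Real.log (t / ⌊t⌋₊) ^ (k + 1) / (k + 1) ≤ (1 + Real.log t) ^ k := by
      have : (1 : ℝ) ≤ (1 + Real.log t) ^ k := one_le_pow₀ (by linarith)
      rw [div_le_iff₀ (by positivity)]
      have h6 : Real.log (t / ⌊t⌋₊) ^ (k + 1) ≤ 1 := pow_le_one₀ h3 h4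
      nlinarith [(by positivity : (0 : ℝ) ≤ k)]
    have h7 : Real.log t ^ k ≤ (1 + Real.log t) ^ k := by gcongr; linarith
    have h8 : 0 ≤ Real.log (t / ⌊t⌋₊) ^ (k + 1) / (k + 1) := by positivity
    have e1 : ∑ n ∈ Finset.Icc 1 ⌊t⌋₊, Real.log n ^ 0 / n * Real.log (t / n) ^ k =
        ∑ n ∈ Finset.Icc 1 ⌊t⌋₊, Real.log (t / n) ^ k / n :=
      Finset.sum_congr rfl fun n _ => by ring
    have e2 : (Nat.factorial 0 * k.factorial / (0 + k + 1).factorial : ℝ) = 1 / (k + 1) := by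
      rw [zero_add, Nat.factorial_succ]
      push_cast
      simp only [Nat.factorial_zero, Nat.cast_one]
      field_simp
    rw [e1, e2, zero_add, abs_le]
    rw [sub_div] at h1 h2
    have h9 : 0 ≤ Real.log (t / ⌊t⌋₊) ^ k / ⌊t⌋₊ := by positivity
    have e3 : 1 / ((k : ℝ) + 1) * Real.log t ^ (k + 1) = Real.log t ^ (k + 1) / (k + 1) := by ring
    constructor <;> linarith
  | succ a ih =>
    obtain ⟨C₁, hC₁, h₁⟩ := ih k
    obtain ⟨C₂, hC₂, h₂⟩ := ih (k + 1)
    refine ⟨C₁ + C₂, by positivity, fun t ht => ?_⟩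
    have hT := Real.log_nonneg ht
    have e : ∑ n ∈ Finset.Icc 1 ⌊t⌋₊, Real.log n ^ (a + 1) / n * Real.log (t / n) ^ k =
        Real.log t * (∑ n ∈ Finset.Icc 1 ⌊t⌋₊, Real.log n ^ a / n * Real.log (t / n) ^ k) -
        ∑ n ∈ Finset.Icc 1 ⌊t⌋₊, Real.log n ^ a / n * Real.log (t / n) ^ (k + 1) := by
      rw [Finset.mul_sum, ← Finset.sum_sub_distrib]
      refine Finset.sum_congr rfl fun n hn => ?_
      have hn1 : 1 ≤ n := (Finset.mem_Icc.1 hn).1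
      have : Real.log n = Real.log t - Real.log (t / n) := by
        rw [Real.log_div (by linarith) (by positivity)]; ring
      rw [pow_succ, this]
      ring
    have h1 := h₁ t ht
    have h2 := h₂ t ht
    have hf : (((a + 1).factorial * k.factorial / (a + 1 + k + 1).factorial : ℝ)) =
        (a.factorial * k.factorial / (a + k + 1).factorial : ℝ) -
        (a.factorial * (k + 1).factorial / (a + (k + 1) + 1).factorial : ℝ) := by
      rw [show a + 1 + k + 1 = (a + k + 1) + 1 by ring, show a + (k + 1) + 1 = (a + k + 1) + 1 by ring,
        Nat.factorial_succ (a + k + 1), Nat.factorial_succ a, Nat.factorial_succ k]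
      push_cast
      field_simp
      ring
    rw [e, hf]
    rw [show a + (k + 1) = a + k + 1 by ring] at h2 ⊢
    rw [show a + 1 + k = a + k + 1 by ring]
    have h3 := mul_le_mul_of_nonneg_left h1 hT
    rw [← abs_of_nonneg hT, ← abs_mul, abs_of_nonneg hT] at h3
    have h4 : Real.log t * (C₁ * (1 + Real.log t) ^ (a + k)) ≤ C₁ * (1 + Real.log t) ^ (a + k + 1) := by
      rw [pow_succ]
      have : 0 ≤ C₁ * (1 + Real.log t) ^ (a + k) := by positivity
      nlinarith
    rw [abs_le] at h2 h3 ⊢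
    simp only [pow_succ] at *
    constructor <;> linarith [h2.1, h2.2, h3.1, h3.2]

/-- The function `t ↦ ∑_{n ≤ t} (log n)^a / n * W (t / n)`. -/
noncomputable def logSum (a : ℕ) (W : ℝ → ℝ) (t : ℝ) : ℝ :=
  ∑ n ∈ Finset.Icc 1 ⌊t⌋₊, Real.log n ^ a / n * W (t / n)

/-- `W x = c (log x)^(k+1) + O((1 + log x)^k)` for `x ≥ 1`. -/
def HasLogOrder (W : ℝ → ℝ) (c : ℝ) (k : ℕ) : Prop :=
  ∃ C : ℝ, 0 ≤ C ∧ ∀ x : ℝ, 1 ≤ x →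
    |W x - c * Real.log x ^ (k + 1)| ≤ C * (1 + Real.log x) ^ k

theorem hasLogOrder_logSum_one (a : ℕ) :
    HasLogOrder (logSum a fun _ => 1) (a.factorial / (a + 1).factorial) a := by
  obtain ⟨C, hC, h⟩ := exists_sum_log_pow_mul_log_div_pow a 0
  refine ⟨C, hC, fun x hx => ?_⟩
  simpa [logSum] using h x hx

theorem HasLogOrder.exists_abs_le {W : ℝ → ℝ} {c : ℝ} {k : ℕ} (h : HasLogOrder W c k) :
    ∃ C : ℝ, 0 ≤ C ∧ ∀ x : ℝ, 1 ≤ x → |W x| ≤ C * (1 + Real.log x) ^ (k + 1) := by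
  obtain ⟨C, hC, h⟩ := h
  refine ⟨C + |c|, by positivity, fun x hx => ?_⟩
  have hX := Real.log_nonneg hx
  have h1 := h x hx
  have h2 : |W x| ≤ |W x - c * Real.log x ^ (k + 1)| + |c * Real.log x ^ (k + 1)| := by
    simpa using abs_add_le (W x - c * Real.log x ^ (k + 1)) (c * Real.log x ^ (k + 1))
  have h3 : |c * Real.log x ^ (k + 1)| ≤ |c| * (1 + Real.log x) ^ (k + 1) := by
    rw [abs_mul, abs_of_nonneg (pow_nonneg hX _)]
    gcongr
    linarith
  have h4 : C * (1 + Real.log x) ^ k ≤ C * (1 + Real.log x) ^ (k + 1) := by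
    gcongr
    · linarith
    · omega
  linarith

theorem HasLogOrder.logSum {W : ℝ → ℝ} {c : ℝ} {k : ℕ} (h : HasLogOrder W c k) (a : ℕ) :
    HasLogOrder (logSum a W)
      (c * (a.factorial * (k + 1).factorial / (a + k + 2).factorial)) (a + k + 1) := by
  obtain ⟨C₁, hC₁, h₁⟩ := h
  obtain ⟨C₂, hC₂, h₂⟩ := exists_sum_log_pow_mul_log_div_pow a (k + 1)
  obtain ⟨C₃, hC₃, h₃⟩ := (hasLogOrder_logSum_one a).exists_abs_le
  refine ⟨|c| * C₂ + C₁ * C₃, by positivity, fun t ht => ?_⟩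
  have hT := Real.log_nonneg ht
  set M := ∑ n ∈ Finset.Icc 1 ⌊t⌋₊, Real.log n ^ a / n * Real.log (t / n) ^ (k + 1) with hM
  have e : _root_.logSum a W t - c * M =
      ∑ n ∈ Finset.Icc 1 ⌊t⌋₊,
        Real.log n ^ a / n * (W (t / n) - c * Real.log (t / n) ^ (k + 1)) := by
    rw [_root_.logSum, hM, Finset.mul_sum, ← Finset.sum_sub_distrib]
    exact Finset.sum_congr rfl fun n _ => by ring
  have h4 : |_root_.logSum a W t - c * M| ≤ C₁ * C₃ * (1 + Real.log t) ^ (a + k + 1) := by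
    rw [e]
    calc _ ≤ ∑ n ∈ Finset.Icc 1 ⌊t⌋₊, Real.log n ^ a / n * (C₁ * (1 + Real.log t) ^ k) := by
          refine (Finset.abs_sum_le_sum_abs _ _).trans (Finset.sum_le_sum fun n hn => ?_)
          obtain ⟨hn1, hn2⟩ := Finset.mem_Icc.1 hn
          have hn1' : (1 : ℝ) ≤ n := by exact_mod_cast hn1
          have hnt : (n : ℝ) ≤ t := (Nat.le_floor_iff (by linarith)).1 hn2
          have hx : 1 ≤ t / n := by rw [le_div_iff₀ (by linarith)]; linarith
          have hl : 0 ≤ Real.log n := Real.log_nonneg hn1'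
          have hX := Real.log_nonneg hx
          have hXT : Real.log (t / n) ≤ Real.log t :=
            Real.log_le_log (by linarith) (div_le_self (by linarith) hn1')
          rw [abs_mul, abs_of_nonneg (by positivity : 0 ≤ Real.log n ^ a / n)]
          refine mul_le_mul_of_nonneg_left ((h₁ _ hx).trans ?_) (by positivity)
          gcongr
      _ = _root_.logSum a (fun _ => 1) t * (C₁ * (1 + Real.log t) ^ k) := by
          simp [_root_.logSum, Finset.sum_mul]
      _ ≤ (C₃ * (1 + Real.log t) ^ (a + 1)) * (C₁ * (1 + Real.log t) ^ k) := by
          gcongr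
          exact (le_abs_self _).trans (h₃ t ht)
      _ = _ := by ring
  have h5 := mul_le_mul_of_nonneg_left (h₂ t ht) (abs_nonneg c)
  rw [← abs_mul] at h5
  rw [show a + k + 2 = a + k + 1 + 1 by ring]
  rw [show a + (k + 1) = a + k + 1 by ring] at h5
  have h6 := abs_add_le (_root_.logSum a W t - c * M) (c * (M - a.factorial * (k + 1).factorial /
    (a + k + 1 + 1).factorial * Real.log t ^ (a + k + 1 + 1)))
  refine le_trans (le_of_eq ?_) (h6.trans (le_trans (add_le_add h4 h5) (le_of_eq ?_)))
  · congr 1; ring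
  · ring

/-- The quadruples of positive integers with product at most `N`. -/
def quadsLE (N : ℕ) : Finset (ℕ × ℕ × ℕ × ℕ) :=
  (Finset.Icc 1 N ×ˢ Finset.Icc 1 N ×ˢ Finset.Icc 1 N ×ˢ Finset.Icc 1 N).filter
    fun q => q.1 * q.2.1 * q.2.2.1 * q.2.2.2 ≤ N

theorem mem_quadsLE {N g u v h : ℕ} : (g, u, v, h) ∈ quadsLE N ↔
    1 ≤ g ∧ 1 ≤ u ∧ 1 ≤ v ∧ 1 ≤ h ∧ g * u * v * h ≤ N := by
  simp only [quadsLE, Finset.mem_filter, Finset.mem_product, Finset.mem_Icc]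
  constructor
  · tauto
  · rintro ⟨h1, h2, h3, h4, h5⟩
    have a1 : g * u * v * 1 ≤ g * u * v * h := Nat.mul_le_mul_left _ h4
    have a2 : g * u * 1 ≤ g * u * v := Nat.mul_le_mul_left _ h3
    have a3 : g * 1 ≤ g * u := Nat.mul_le_mul_left _ h2
    have b1 : 1 * h ≤ g * u * v * h := Nat.mul_le_mul_right _ (by nlinarith)
    have b2 : 1 * v ≤ g * u * v := Nat.mul_le_mul_right _ (by nlinarith)
    have b3 : 1 * u ≤ g * u := Nat.mul_le_mul_right _ h1
    refine ⟨⟨⟨h1, ?_⟩, ⟨h2, ?_⟩, ⟨h3, ?_⟩, ⟨h4, ?_⟩⟩, h5⟩ <;> lia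

theorem sum_quadsLE (N : ℕ) (F : ℕ → ℕ → ℕ → ℕ → ℝ) :
    ∑ q ∈ quadsLE N, F q.1 q.2.1 q.2.2.1 q.2.2.2 =
      ∑ g ∈ Finset.Icc 1 N, ∑ u ∈ Finset.Icc 1 (N / g), ∑ v ∈ Finset.Icc 1 (N / g / u),
        ∑ h ∈ Finset.Icc 1 (N / g / u / v), F g u v h := by
  simp only [Finset.sum_sigma']
  refine Finset.sum_bij' (fun q _ => ⟨q.1, ⟨q.2.1, ⟨q.2.2.1, q.2.2.2⟩⟩⟩)
    (fun s _ => (s.1, s.2.1, s.2.2.1, s.2.2.2)) ?_ ?_ ?_ ?_ ?_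
  · rintro ⟨g, u, v, h⟩ hq
    have hb := hq
    rw [quadsLE, Finset.mem_filter] at hb
    simp only [Finset.mem_product, Finset.mem_Icc] at hb
    rw [mem_quadsLE] at hq
    obtain ⟨h1, h2, h3, h4, h5⟩ := hq
    simp only [Finset.mem_sigma, Finset.mem_Icc]
    have a1 : g * u * v * 1 ≤ g * u * v * h := Nat.mul_le_mul_left _ h4
    have a2 : g * u * 1 ≤ g * u * v := Nat.mul_le_mul_left _ h3
    refine ⟨⟨h1, hb.1.1.2⟩, ⟨h2, ?_⟩, ⟨h3, ?_⟩, h4, ?_⟩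
    · rw [Nat.le_div_iff_mul_le (by lia)]; lia
    · rw [Nat.div_div_eq_div_mul, Nat.le_div_iff_mul_le (by positivity)]; lia
    · rw [Nat.div_div_eq_div_mul, Nat.div_div_eq_div_mul, Nat.le_div_iff_mul_le (by positivity)]
      lia
  · rintro ⟨g, u, v, h⟩ hs
    simp only [Finset.mem_sigma, Finset.mem_Icc] at hs
    obtain ⟨⟨h1, _⟩, ⟨h2, _⟩, ⟨h3, _⟩, h4, h5⟩ := hs
    rw [Nat.div_div_eq_div_mul, Nat.div_div_eq_div_mul,
      Nat.le_div_iff_mul_le (by positivity)] at h5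
    exact mem_quadsLE.2 ⟨h1, h2, h3, h4, by lia⟩
  · rintro _ _; rfl
  · rintro _ _; rfl
  · rintro _ _; rfl

/-- `∑_{guvh ≤ t} (log g)^a (log u)^b (log v)^c (log h)^e / (guvh)`. -/
noncomputable def quadLogSum (a b c e : ℕ) (t : ℝ) : ℝ :=
  ∑ q ∈ quadsLE ⌊t⌋₊, Real.log q.1 ^ a / q.1 * (Real.log q.2.1 ^ b / q.2.1 *
    (Real.log q.2.2.1 ^ c / q.2.2.1 * (Real.log q.2.2.2 ^ e / q.2.2.2 * 1)))

theorem quadLogSum_eq (a b c e : ℕ) :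
    quadLogSum a b c e = logSum a (logSum b (logSum c (logSum e fun _ => 1))) := by
  funext t
  rw [quadLogSum, sum_quadsLE ⌊t⌋₊ fun g u v h => Real.log g ^ a / g * (Real.log u ^ b / u *
    (Real.log v ^ c / v * (Real.log h ^ e / h * 1)))]
  simp only [logSum, Nat.floor_div_natCast, Finset.mul_sum]

theorem hasLogOrder_quadLogSum (a b c e : ℕ) :
    HasLogOrder (quadLogSum a b c e)
      (a.factorial * b.factorial * c.factorial * e.factorial / (a + b + c + e + 4).factorial)
      (a + b + c + e + 3) := by
  rw [quadLogSum_eq]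
  have h := (((hasLogOrder_logSum_one e).logSum c).logSum b).logSum a
  have e1 : a + (b + (c + e + 1) + 1) + 1 = a + b + c + e + 3 := by ring
  have e2 : a + (b + (c + e + 1) + 1) + 2 = a + b + c + e + 4 := by ring
  have e3 : b + (c + e + 1) + 1 + 1 = b + (c + e + 1) + 2 := by ring
  have e4 : c + e + 1 + 1 = c + e + 2 := by ring
  rw [e1, e2, e3, e4] at h
  convert h using 1
  field_simp

/-- The product of `log m + δ` over `m` in `gu, vh, gv, uh`. -/
noncomputable def quadLogProd (δ : ℝ) (q : ℕ × ℕ × ℕ × ℕ) : ℝ :=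
  (Real.log q.1 + Real.log q.2.1 + δ) * (Real.log q.2.2.1 + Real.log q.2.2.2 + δ) *
    ((Real.log q.1 + Real.log q.2.2.1 + δ) * (Real.log q.2.1 + Real.log q.2.2.2 + δ))

/-- The sum over `guvh ≤ t` of the shifted product of logarithms, weighted by `1 / (guvh)`. -/
noncomputable def shiftedQuadSum (δ t : ℝ) : ℝ :=
  ∑ q ∈ quadsLE ⌊t⌋₊, quadLogProd δ q / (q.1 * q.2.1 * q.2.2.1 * q.2.2.2 : ℝ)

theorem HasLogOrder.add {W V : ℝ → ℝ} {c d : ℝ} {k : ℕ} (hW : HasLogOrder W c k)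
    (hV : HasLogOrder V d k) : HasLogOrder (fun x => W x + V x) (c + d) k := by
  obtain ⟨C, hC, h⟩ := hW
  obtain ⟨D, hD, h'⟩ := hV
  refine ⟨C + D, by positivity, fun x hx => ?_⟩
  have := abs_add_le (W x - c * Real.log x ^ (k + 1)) (V x - d * Real.log x ^ (k + 1))
  refine le_trans (le_of_eq ?_) (this.trans ((add_le_add (h x hx) (h' x hx)).trans (le_of_eq ?_)))
  · congr 1; ring
  · ring

theorem HasLogOrder.const_mul {W : ℝ → ℝ} {c : ℝ} {k : ℕ} (hW : HasLogOrder W c k) (b : ℝ) :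
    HasLogOrder (fun x => b * W x) (b * c) k := by
  obtain ⟨C, hC, h⟩ := hW
  refine ⟨|b| * C, by positivity, fun x hx => ?_⟩
  have := mul_le_mul_of_nonneg_left (h x hx) (abs_nonneg b)
  rw [← abs_mul] at this
  refine le_trans (le_of_eq ?_) (this.trans (le_of_eq ?_))
  · congr 1; ring
  · ring

theorem hasLogOrder_shiftedQuadSum_zero :
    HasLogOrder (shiftedQuadSum 0) (17 / 20160) 7 := by
  have h₁ := ((((((((((((((hasLogOrder_quadLogSum 2 1 1 0).add
      (hasLogOrder_quadLogSum 2 0 1 1)).add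
      (hasLogOrder_quadLogSum 1 1 2 0)).add
      (hasLogOrder_quadLogSum 1 0 2 1)).add
      (hasLogOrder_quadLogSum 2 1 0 1)).add
      (hasLogOrder_quadLogSum 1 0 1 2)).add
      (hasLogOrder_quadLogSum 1 2 1 0)).add
      (hasLogOrder_quadLogSum 0 1 2 1)).add
      (hasLogOrder_quadLogSum 1 2 0 1)).add
      (hasLogOrder_quadLogSum 1 1 0 2)).add
      (hasLogOrder_quadLogSum 0 2 1 1)).add
      (hasLogOrder_quadLogSum 0 1 1 2)).add
      (hasLogOrder_quadLogSum 2 0 0 2)).add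
      (hasLogOrder_quadLogSum 0 2 2 0))
  have h₂ := (hasLogOrder_quadLogSum 1 1 1 1).const_mul 2
  have h : HasLogOrder _ _ 7 := h₁.add h₂
  convert h using 1
  · funext t
    simp only [shiftedQuadSum, quadLogProd, quadLogSum, Finset.mul_sum, ← Finset.sum_add_distrib]
    refine Finset.sum_congr rfl fun q _ => ?_
    simp only [div_eq_mul_inv, mul_inv]
    ring
  · norm_num [Nat.factorial]

theorem quad_mul_add_sub_le {T δ y₁ y₂ y₃ y₄ : ℝ} (hδ : 0 ≤ δ) (hδT : δ ≤ T) (h₁ : 0 ≤ y₁)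
    (h₁' : y₁ ≤ T) (h₂ : 0 ≤ y₂) (h₂' : y₂ ≤ T) (h₃ : 0 ≤ y₃) (h₃' : y₃ ≤ T) (h₄ : 0 ≤ y₄)
    (h₄' : y₄ ≤ T) :
    |(y₁ + δ) * (y₂ + δ) * ((y₃ + δ) * (y₄ + δ)) - y₁ * y₂ * (y₃ * y₄)| ≤ 15 * δ * T ^ 3 := by
  have hT : 0 ≤ T := hδ.trans hδT
  have e : (y₁ + δ) * (y₂ + δ) * ((y₃ + δ) * (y₄ + δ)) - y₁ * y₂ * (y₃ * y₄) =
      δ * ((y₁ + y₂ + δ) * (y₃ * y₄) + (y₃ + y₄ + δ) * (y₁ * y₂) +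
        δ * ((y₁ + y₂ + δ) * (y₃ + y₄ + δ))) := by ring
  rw [e, abs_of_nonneg (by positivity)]
  calc _ ≤ δ * ((T + T + T) * (T * T) + (T + T + T) * (T * T) +
        T * ((T + T + T) * (T + T + T))) := by gcongr
    _ = _ := by ring

theorem exists_shiftedQuadSum_sub_le : ∃ C : ℝ, 0 ≤ C ∧ ∀ δ T x : ℝ, 0 ≤ δ → δ ≤ T → 1 ≤ x →
    Real.log x ≤ T → |shiftedQuadSum δ x - shiftedQuadSum 0 x| ≤ C * δ * (1 + T) ^ 7 := by
  obtain ⟨C, hC, h⟩ := (hasLogOrder_quadLogSum 0 0 0 0).exists_abs_le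
  refine ⟨15 * C, by positivity, fun δ T x hδ hδT hx hxT => ?_⟩
  have hX := Real.log_nonneg hx
  have hT : 0 ≤ T := hδ.trans hδT
  have key : ∀ q ∈ quadsLE ⌊x⌋₊, |quadLogProd δ q - quadLogProd 0 q| ≤ 15 * δ * T ^ 3 := by
    rintro ⟨g, u, v, k⟩ hq
    obtain ⟨h1, h2, h3, h4, h5⟩ := mem_quadsLE.1 hq
    have hg : 0 ≤ Real.log g := Real.log_natCast_nonneg g
    have hu : 0 ≤ Real.log u := Real.log_natCast_nonneg u
    have hv : 0 ≤ Real.log v := Real.log_natCast_nonneg v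
    have hk : 0 ≤ Real.log k := Real.log_natCast_nonneg k
    have hs : Real.log g + Real.log u + Real.log v + Real.log k ≤ T := by
      rw [← Real.log_mul (by positivity) (by positivity),
        ← Real.log_mul (by positivity) (by positivity),
        ← Real.log_mul (by positivity) (by positivity)]
      refine le_trans (Real.log_le_log (by positivity) ?_) hxT
      exact_mod_cast (Nat.le_floor_iff (by linarith)).1 h5
    simp only [quadLogProd, add_zero]
    apply quad_mul_add_sub_le <;> linarith
  calc |shiftedQuadSum δ x - shiftedQuadSum 0 x| ≤
      ∑ q ∈ quadsLE ⌊x⌋₊, 15 * δ * T ^ 3 / (q.1 * q.2.1 * q.2.2.1 * q.2.2.2 : ℝ) := by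
        rw [shiftedQuadSum, shiftedQuadSum, ← Finset.sum_sub_distrib]
        refine (Finset.abs_sum_le_sum_abs _ _).trans (Finset.sum_le_sum fun q hq => ?_)
        rw [← sub_div, abs_div, abs_of_nonneg (by positivity : (0 : ℝ) ≤ q.1 * q.2.1 * q.2.2.1 * q.2.2.2)]
        gcongr
        exact key q hq
    _ = 15 * δ * T ^ 3 * quadLogSum 0 0 0 0 x := by
        rw [quadLogSum, Finset.mul_sum]
        refine Finset.sum_congr rfl fun q _ => ?_
        simp only [div_eq_mul_inv, mul_inv]
        ring
    _ ≤ 15 * δ * (1 + T) ^ 3 * (C * (1 + T) ^ 4) := by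
        have h1 : quadLogSum 0 0 0 0 x ≤ C * (1 + T) ^ 4 := by
          refine (le_abs_self _).trans ((h x hx).trans ?_)
          norm_num only
          gcongr
        refine (mul_le_mul_of_nonneg_left h1 (by positivity)).trans ?_
        gcongr
        linarith
    _ = _ := by ring

theorem quadsLE_zero : quadsLE 0 = ∅ := by
  simp [quadsLE]

theorem exists_shiftedQuadSum_div_sq_sub_le : ∃ C : ℝ, 0 ≤ C ∧ ∀ t : ℝ, 1 ≤ t → ∀ d : ℕ, 1 ≤ d →
    |shiftedQuadSum (Real.log d) (t / d ^ 2) - 17 / 20160 * Real.log t ^ 8| ≤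
      C * (1 + Real.log d) * (1 + Real.log t) ^ 7 := by
  obtain ⟨C₁, hC₁, h₁⟩ := exists_shiftedQuadSum_sub_le
  obtain ⟨C₂, hC₂, h₂⟩ := hasLogOrder_shiftedQuadSum_zero
  refine ⟨C₁ + C₂ + 1, by positivity, fun t ht d hd => ?_⟩
  set T := Real.log t with hTdef
  set δ := Real.log d with hδdef
  have hT : 0 ≤ T := Real.log_nonneg ht
  have hd' : (1 : ℝ) ≤ d := by exact_mod_cast hd
  have hδ : 0 ≤ δ := Real.log_nonneg hd'
  have hT7 : T ^ 7 ≤ (1 + T) ^ 7 := by gcongr; linarith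
  have hlog : Real.log ((d : ℝ) ^ 2) = 2 * δ := by rw [Real.log_pow]; norm_num [hδdef]
  rcases lt_or_ge t ((d : ℝ) ^ 2) with hlt | hge
  · have h0 : ⌊t / (d : ℝ) ^ 2⌋₊ = 0 := by
      rw [Nat.floor_eq_zero, div_lt_one (by positivity)]
      exact hlt
    have hTδ : T ≤ 2 * δ := by
      rw [← hlog]
      exact Real.log_le_log (by linarith) hlt.le
    rw [shiftedQuadSum, h0, quadsLE_zero, Finset.sum_empty, zero_sub, abs_neg,
      abs_of_nonneg (by positivity)]
    have h1 : 17 / 20160 * T ≤ (C₁ + C₂ + 1) * (1 + δ) := by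
      nlinarith [mul_nonneg hC₁ hδ, mul_nonneg hC₂ hδ]
    calc 17 / 20160 * T ^ 8 = 17 / 20160 * T * T ^ 7 := by ring
      _ ≤ (C₁ + C₂ + 1) * (1 + δ) * (1 + T) ^ 7 :=
        mul_le_mul h1 hT7 (by positivity) (by positivity)
  · set x := t / (d : ℝ) ^ 2 with hx
    have hx1 : 1 ≤ x := by rw [hx, le_div_iff₀ (by positivity)]; linarith
    have hX0 := Real.log_nonneg hx1
    have hX : Real.log x = T - 2 * δ := by
      rw [hx, Real.log_div (by linarith) (by positivity), hlog]
    have h3 := h₁ δ T x hδ (by linarith) hx1 (by linarith)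
    have h4 := h₂ x hx1
    have h5 : C₂ * (1 + Real.log x) ^ 7 ≤ C₂ * (1 + T) ^ 7 := by
      gcongr; linarith
    obtain ⟨-, h6⟩ := pow_succ_sub_pow_succ_bounds hX0 (by linarith : Real.log x ≤ T) 7
    have h7 : Real.log x ^ 8 ≤ T ^ 8 := by gcongr; linarith
    have h8 : T ^ 8 - Real.log x ^ 8 ≤ 16 * δ * (1 + T) ^ 7 := by
      norm_num only at h6
      rw [show T - Real.log x = 2 * δ by linarith] at h6
      have := mul_le_mul_of_nonneg_left hT7 hδ
      linarith
    have hp : 0 ≤ (1 + T) ^ 7 := by positivity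
    have hp1 : 0 ≤ C₁ * (1 + T) ^ 7 := by positivity
    have hp2 : 0 ≤ C₂ * δ * (1 + T) ^ 7 := by positivity
    have hp3 : 0 ≤ δ * (1 + T) ^ 7 := by positivity
    norm_num only at h4
    rw [abs_le] at *
    constructor <;> linarith [h3.1, h3.2, h4.1, h4.2]

theorem sum_moebius_of_dvd_gcd (N : ℕ) {u v : ℕ} (hu : 1 ≤ u) (huN : u ≤ N) :
    ∑ d ∈ Finset.Icc 1 N, (if d ∣ u ∧ d ∣ v then (ArithmeticFunction.moebius d : ℝ) else 0) =
      if u.Coprime v then 1 else 0 := by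
  have h : (∑ d ∈ (u.gcd v).divisors, (ArithmeticFunction.moebius d : ℤ)) =
      if u.gcd v = 1 then 1 else 0 := by
    rw [← ArithmeticFunction.coe_mul_zeta_apply, ArithmeticFunction.moebius_mul_coe_zeta,
      ArithmeticFunction.one_apply]
  have hg : u.gcd v ≠ 0 := by
    intro h
    have := Nat.eq_zero_of_gcd_eq_zero_left h
    omega
  rw [← Finset.sum_filter]
  have e : (Finset.Icc 1 N).filter (fun d => d ∣ u ∧ d ∣ v) = (u.gcd v).divisors := by
    ext d
    simp only [Finset.mem_filter, Finset.mem_Icc, Nat.mem_divisors, ← Nat.dvd_gcd_iff]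
    constructor
    · exact fun h => ⟨h.2, hg⟩
    · intro h
      have h1 : d ∣ u := h.1.trans (Nat.gcd_dvd_left _ _)
      exact ⟨⟨Nat.pos_of_dvd_of_pos h1 hu, (Nat.le_of_dvd hu h1).trans huN⟩, h.1⟩
  rw [e, ← Int.cast_sum, h]
  simp only [Nat.coprime_iff_gcd_eq_one]
  split_ifs <;> simp

theorem sum_quadsLE_dvd (N d : ℕ) (hd : 1 ≤ d) (F : ℕ × ℕ × ℕ × ℕ → ℝ) :
    ∑ q ∈ (quadsLE N).filter (fun q => d ∣ q.2.1 ∧ d ∣ q.2.2.1), F q =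
      ∑ q ∈ quadsLE (N / d ^ 2), F (q.1, d * q.2.1, d * q.2.2.1, q.2.2.2) := by
  symm
  refine Finset.sum_nbij (fun q => (q.1, d * q.2.1, d * q.2.2.1, q.2.2.2)) ?_ ?_ ?_ ?_
  · rintro ⟨g, u, v, h⟩ hq
    obtain ⟨h1, h2, h3, h4, h5⟩ := mem_quadsLE.1 hq
    rw [Nat.le_div_iff_mul_le (by positivity)] at h5
    simp only [Finset.mem_filter, mem_quadsLE]
    exact ⟨⟨h1, Nat.mul_pos hd h2, Nat.mul_pos hd h3, h4, by nlinarith⟩,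
      dvd_mul_right _ _, dvd_mul_right _ _⟩
  · rintro ⟨g, u, v, h⟩ _ ⟨g', u', v', h'⟩ _ heq
    simp only [Prod.mk.injEq] at heq ⊢
    exact ⟨heq.1, Nat.eq_of_mul_eq_mul_left hd heq.2.1, Nat.eq_of_mul_eq_mul_left hd heq.2.2.1,
      heq.2.2.2⟩
  · rintro ⟨g, u, v, h⟩ hq
    simp only [Finset.coe_filter, Set.mem_ofPred_eq, mem_quadsLE] at hq
    obtain ⟨⟨h1, h2, h3, h4, h5⟩, ⟨u', rfl⟩, ⟨v', rfl⟩⟩ := hq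
    refine ⟨(g, u', v', h), ?_, rfl⟩
    rw [Finset.mem_coe, mem_quadsLE, Nat.le_div_iff_mul_le (by positivity)]
    exact ⟨h1, Nat.pos_of_mul_pos_left h2, Nat.pos_of_mul_pos_left h3, h4, by nlinarith⟩
  · intro _ _; rfl

theorem sum_alphaFn_sq_div (N : ℕ) :
    ∑ n ∈ Finset.Icc 1 N, alphaFn n ^ 2 / n =
      ∑ q ∈ (quadsLE N).filter (fun q => q.2.1.Coprime q.2.2.1),
        quadLogProd 0 q / (q.1 * q.2.1 * q.2.2.1 * q.2.2.2 : ℝ) := by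
  have e : ∀ n ∈ Finset.Icc 1 N, alphaFn n ^ 2 / n =
      ∑ p ∈ n.divisorsAntidiagonal ×ˢ n.divisorsAntidiagonal,
        Real.log p.1.1 * Real.log p.1.2 * (Real.log p.2.1 * Real.log p.2.2) / n := by
    intro n _
    rw [alphaFn, sq, Finset.sum_mul_sum, Finset.sum_product, Finset.sum_div]
    exact Finset.sum_congr rfl fun _ _ => Finset.sum_div _ _ _
  rw [Finset.sum_congr rfl e, Finset.sum_sigma']
  symm
  refine Finset.sum_nbij (fun q => ⟨q.1 * q.2.1 * q.2.2.1 * q.2.2.2,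
    ((q.1 * q.2.1, q.2.2.1 * q.2.2.2), (q.1 * q.2.2.1, q.2.1 * q.2.2.2))⟩) ?_ ?_ ?_ ?_
  · rintro ⟨g, u, v, h⟩ hq
    simp only [Finset.mem_filter, mem_quadsLE] at hq
    obtain ⟨⟨h1, h2, h3, h4, h5⟩, hc⟩ := hq
    have : 0 < g * u * v * h := by positivity
    simp only [Finset.mem_sigma, Finset.mem_Icc, Finset.mem_product, Nat.mem_divisorsAntidiagonal]
    exact ⟨⟨this, h5⟩, ⟨by ring, this.ne'⟩, ⟨by ring, this.ne'⟩⟩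
  · rintro ⟨g, u, v, h⟩ hq ⟨g', u', v', h'⟩ hq' heq
    simp only [Finset.coe_filter, Set.mem_ofPred_eq, mem_quadsLE] at hq hq'
    obtain ⟨⟨h1, h2, h3, h4, h5⟩, hc⟩ := hq
    obtain ⟨⟨h1', h2', h3', h4', h5'⟩, hc'⟩ := hq'
    simp only [Sigma.mk.injEq, heq_eq_eq, Prod.mk.injEq] at heq
    obtain ⟨-, ⟨e1, e2⟩, e3, e4⟩ := heq
    have hg : g = g' := by
      have a1 : (g * u).gcd (g * v) = g := by rw [Nat.gcd_mul_left, hc, mul_one]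
      have a2 : (g' * u').gcd (g' * v') = g' := by rw [Nat.gcd_mul_left, hc', mul_one]
      rw [← a1, ← a2, e1, e3]
    subst hg
    obtain rfl := Nat.eq_of_mul_eq_mul_left h1 e1
    obtain rfl := Nat.eq_of_mul_eq_mul_left h1 e3
    obtain rfl := Nat.eq_of_mul_eq_mul_left h3 e2
    rfl
  · rintro ⟨n, ⟨a, b⟩, ⟨c, e⟩⟩ hs
    simp only [Finset.coe_sigma, Set.mem_sigma_iff, Finset.mem_coe, Finset.mem_Icc,
      Finset.mem_product, Nat.mem_divisorsAntidiagonal] at hs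
    obtain ⟨⟨hn1, hnN⟩, ⟨hab, -⟩, ⟨hce, -⟩⟩ := hs
    have ha : 0 < a := Nat.pos_of_ne_zero (by rintro rfl; simp at hab; omega)
    have hb : 0 < b := Nat.pos_of_ne_zero (by rintro rfl; simp at hab; omega)
    have hc : 0 < c := Nat.pos_of_ne_zero (by rintro rfl; simp at hce; omega)
    obtain ⟨g, u, v, hg, huv, rfl, rfl⟩ := Nat.exists_coprime' (m := a) (n := c)
      (Nat.gcd_pos_of_pos_left _ ha)
    have hu : 0 < u := Nat.pos_of_mul_pos_right ha
    have hv : 0 < v := Nat.pos_of_mul_pos_right hc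
    have huv' : u * b = v * e := by
      apply Nat.eq_of_mul_eq_mul_left hg
      linarith
    obtain ⟨h, rfl⟩ : v ∣ b := huv.symm.dvd_of_dvd_mul_left ⟨e, huv'⟩
    have he : e = u * h := by
      apply Nat.eq_of_mul_eq_mul_left hv
      linarith
    subst he
    have hh : 0 < h := Nat.pos_of_mul_pos_left hb
    subst hab
    refine ⟨(g, u, v, h), ?_, ?_⟩
    · simp only [Finset.coe_filter, Set.mem_ofPred_eq, mem_quadsLE]
      exact ⟨⟨hg, hu, hv, hh, by nlinarith⟩, huv⟩
    · simp only [Sigma.mk.injEq, heq_eq_eq, Prod.mk.injEq]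
      refine ⟨by ring, ⟨by ring, trivial⟩, by ring, trivial⟩
  · rintro ⟨g, u, v, h⟩ hq
    simp only [Finset.mem_filter, mem_quadsLE] at hq
    obtain ⟨⟨h1, h2, h3, h4, h5⟩, hc⟩ := hq
    simp only [quadLogProd, add_zero]
    push_cast
    rw [Real.log_mul (by positivity) (by positivity), Real.log_mul (by positivity) (by positivity),
      Real.log_mul (by positivity) (by positivity), Real.log_mul (by positivity) (by positivity)]

theorem sum_alphaFn_sq_div_eq_sum_moebius (t : ℝ) :
    ∑ n ∈ Finset.Icc 1 ⌊t⌋₊, alphaFn n ^ 2 / n =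
      ∑ d ∈ Finset.Icc 1 ⌊t⌋₊, (ArithmeticFunction.moebius d : ℝ) / d ^ 2 *
        shiftedQuadSum (Real.log d) (t / d ^ 2) := by
  set N := ⌊t⌋₊ with hN
  set G : ℕ × ℕ × ℕ × ℕ → ℝ := fun q => quadLogProd 0 q / (q.1 * q.2.1 * q.2.2.1 * q.2.2.2 : ℝ)
    with hG
  calc _ = ∑ q ∈ quadsLE N, ∑ d ∈ Finset.Icc 1 N,
        (if d ∣ q.2.1 ∧ d ∣ q.2.2.1 then (ArithmeticFunction.moebius d : ℝ) else 0) * G q := by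
        rw [sum_alphaFn_sq_div, Finset.sum_filter]
        refine Finset.sum_congr rfl fun q hq => ?_
        have hq' := (Finset.mem_filter.1 hq).1
        simp only [Finset.mem_product, Finset.mem_Icc] at hq'
        rw [← Finset.sum_mul, sum_moebius_of_dvd_gcd N hq'.2.1.1 hq'.2.1.2]
        split_ifs <;> simp [hG]
    _ = ∑ d ∈ Finset.Icc 1 N, ∑ q ∈ quadsLE N,
        (if d ∣ q.2.1 ∧ d ∣ q.2.2.1 then (ArithmeticFunction.moebius d : ℝ) else 0) * G q :=
        Finset.sum_comm
    _ = _ := by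
        refine Finset.sum_congr rfl fun d hd => ?_
        have hd1 : 1 ≤ d := (Finset.mem_Icc.1 hd).1
        have hfl : ⌊t / (d : ℝ) ^ 2⌋₊ = N / d ^ 2 := by
          rw [hN, ← Nat.floor_div_natCast]
          push_cast
          rfl
        simp only [ite_mul, zero_mul]
        rw [← Finset.sum_filter, ← Finset.mul_sum, sum_quadsLE_dvd N d hd1, shiftedQuadSum, hfl,
          Finset.mul_sum, Finset.mul_sum]
        refine Finset.sum_congr rfl ?_
        rintro ⟨g, u, v, h⟩ hq
        obtain ⟨h1, h2, h3, h4, h5⟩ := mem_quadsLE.1 hq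
        simp only [hG, quadLogProd]
        push_cast
        rw [Real.log_mul (by positivity) (by positivity),
          Real.log_mul (by positivity) (by positivity)]
        field_simp
        ring

theorem tsum_moebius_div_sq :
    ∑' d : ℕ, (ArithmeticFunction.moebius d : ℝ) / d ^ 2 = 6 / Real.pi ^ 2 := by
  have h1 := ArithmeticFunction.LSeries_zeta_mul_Lseries_moebius (s := 2) (by norm_num)
  rw [ArithmeticFunction.LSeries_zeta_eq_riemannZeta (by norm_num), riemannZeta_two] at h1
  have h2 : LSeries (fun n => (ArithmeticFunction.moebius n : ℂ)) 2 =
      ((∑' d : ℕ, (ArithmeticFunction.moebius d : ℝ) / d ^ 2 : ℝ) : ℂ) := by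
    rw [LSeries, Complex.ofReal_tsum]
    refine tsum_congr fun n => ?_
    rcases eq_or_ne n 0 with rfl | hn
    · simp
    · rw [LSeries.term_of_ne_zero hn]
      push_cast
      norm_cast
  rw [h2] at h1
  have h3 : Real.pi ^ 2 / 6 * (∑' d : ℕ, (ArithmeticFunction.moebius d : ℝ) / d ^ 2 : ℝ) = 1 := by
    exact_mod_cast h1
  field_simp at h3 ⊢
  linarith

theorem summable_one_add_log_div_sq :
    Summable fun d : ℕ => (1 + Real.log d) / (d : ℝ) ^ 2 := by
  have hs : Summable fun d : ℕ => 3 * (1 / (d : ℝ) ^ (3 / 2 : ℝ)) :=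
    (Real.summable_one_div_nat_rpow.2 (by norm_num)).mul_left 3
  refine hs.of_nonneg_of_le (fun d => ?_) (fun d => ?_)
  · have := Real.log_natCast_nonneg d
    positivity
  · rcases Nat.eq_zero_or_pos d with rfl | hd
    · simp
    have hd' : (1 : ℝ) ≤ d := by exact_mod_cast hd
    have h1 : Real.log d ≤ (d : ℝ) ^ (1 / 2 : ℝ) / (1 / 2) :=
      Real.log_le_rpow_div (by positivity) (by norm_num)
    have h2 : 1 ≤ (d : ℝ) ^ (1 / 2 : ℝ) := Real.one_le_rpow hd' (by norm_num)
    have h3 : (d : ℝ) ^ 2 = (d : ℝ) ^ (1 / 2 : ℝ) * (d : ℝ) ^ (3 / 2 : ℝ) := by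
      rw [← Real.rpow_add (by positivity)]
      norm_num
    rw [h3, ← div_div, mul_one_div]
    gcongr
    rw [div_le_iff₀ (by positivity)]
    linarith

theorem alpha_squared_mean_value :
    ∃ C : ℝ, 0 < C ∧ ∃ t₀ : ℝ, 3 ≤ t₀ ∧ ∀ t : ℝ, t₀ ≤ t →
      |(∑ n ∈ Finset.Icc 1 ⌊t⌋₊, alphaFn n ^ 2 / n) -
          6 / Real.pi ^ 2 * (17 / 20160) * Real.log t ^ 8| ≤ C * Real.log t ^ 7 := by
  obtain ⟨C, hC, h⟩ := exists_shiftedQuadSum_div_sq_sub_le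
  set S := ∑' d : ℕ, (1 + Real.log d) / (d : ℝ) ^ 2 with hS
  have hS0 : 0 ≤ S := tsum_nonneg fun d => by
    have := Real.log_natCast_nonneg d
    positivity
  refine ⟨C * S * 2 ^ 7 + 1, by positivity, 3, le_rfl, fun t ht => ?_⟩
  set T := Real.log t with hTdef
  have hT1 : 1 ≤ T := by
    rw [hTdef, Real.le_log_iff_exp_le (by linarith)]
    linarith [Real.exp_one_lt_d9]
  have hmu : ∀ d : ℕ, |(ArithmeticFunction.moebius d : ℝ)| ≤ 1 := fun d => by
    exact_mod_cast ArithmeticFunction.abs_moebius_le_one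
  have hsm : Summable fun d : ℕ => (ArithmeticFunction.moebius d : ℝ) / (d : ℝ) ^ 2 := by
    refine summable_one_add_log_div_sq.of_norm_bounded fun d => ?_
    rw [Real.norm_eq_abs, abs_div, abs_of_nonneg (by positivity : (0 : ℝ) ≤ (d : ℝ) ^ 2)]
    gcongr
    linarith [hmu d, Real.log_natCast_nonneg d]
  set A : ℕ → ℝ := fun d => (ArithmeticFunction.moebius d : ℝ) / d ^ 2 *
    shiftedQuadSum (Real.log d) (t / d ^ 2) with hA
  have hA0 : ∀ d ∉ Finset.Icc 1 ⌊t⌋₊, A d = 0 := by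
    intro d hd
    rcases Nat.eq_zero_or_pos d with rfl | hd0
    · simp [hA]
    have hd1 : ⌊t⌋₊ < d := by
      by_contra hcon
      exact hd (Finset.mem_Icc.2 ⟨hd0, not_lt.1 hcon⟩)
    have h1 : t < d := (Nat.floor_lt (by linarith)).1 hd1
    have h2 : ⌊t / (d : ℝ) ^ 2⌋₊ = 0 := by
      rw [Nat.floor_eq_zero, div_lt_one (by positivity)]
      nlinarith
    simp [hA, shiftedQuadSum, h2, quadsLE_zero]
  have hAs : Summable A := summable_of_ne_finset_zero hA0
  have hsm' := hsm.mul_right (17 / 20160 * T ^ 8)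
  have hsb := summable_one_add_log_div_sq.mul_right (C * (1 + T) ^ 7)
  have key : ∀ d : ℕ, ‖A d - (ArithmeticFunction.moebius d : ℝ) / d ^ 2 * (17 / 20160 * T ^ 8)‖ ≤
      (1 + Real.log d) / (d : ℝ) ^ 2 * (C * (1 + T) ^ 7) := by
    intro d
    rcases Nat.eq_zero_or_pos d with rfl | hd0
    · simp [hA]
    rw [hA, ← mul_sub, Real.norm_eq_abs, abs_mul, abs_div,
      abs_of_nonneg (by positivity : (0 : ℝ) ≤ (d : ℝ) ^ 2)]
    calc _ ≤ 1 / (d : ℝ) ^ 2 * (C * (1 + Real.log d) * (1 + T) ^ 7) := by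
          gcongr
          · exact hmu d
          · exact h t (by linarith) d hd0
      _ = _ := by ring
  have hsum : ∑' d, A d = ∑ d ∈ Finset.Icc 1 ⌊t⌋₊, A d := tsum_eq_sum hA0
  rw [sum_alphaFn_sq_div_eq_sum_moebius, ← hsum, ← tsum_moebius_div_sq, mul_assoc,
    ← tsum_mul_right, ← hAs.tsum_sub hsm']
  refine (tsum_of_norm_bounded hsb.hasSum key).trans ?_
  rw [tsum_mul_right, ← hS]
  calc S * (C * (1 + T) ^ 7) ≤ S * (C * (2 * T) ^ 7) := by
        gcongr
        linarith
    _ = C * S * 2 ^ 7 * T ^ 7 := by ring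
    _ ≤ _ := by
        gcongr
        linarith
end
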